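/- arXiv:2602.18601 — 11 statements merged into one kernel-verified Lean document; each statement's English description precedes it below -/
import Mathlib

section
/- Let A be a C*-algebra and let X be a complex Banach space that is a left A-module (with the A-action ℂ-bilinear) satisfying ‖a • x‖ ≤ ‖a‖·‖x‖ for all a ∈ A and x ∈ X. Then the set A•X = {a • x : a ∈ A, x ∈ X} is a closed A-submodule of X; in particular A•X is closed under addition and is closed in the norm topology of X. -/
open Filter Topology

section Factorisation

variable {A : Type*} [NonUnitalNormedRing A] [NormedSpace ℂ A]
  {X : Type*} [NormedAddCommGroup X] [NormedSpace ℂ X]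

/-- The operators `1 - (1 - e) / 3`, for `e` in the unit ball, are surjective, with preimages
bounded by `3`. -/
lemma exists_preimage_of_norm_le_one [CompleteSpace X] (μ : A →ₗ[ℂ] X →ₗ[ℂ] X)
    (hnorm : ∀ (a : A) (x : X), ‖μ a x‖ ≤ ‖a‖ * ‖x‖) {e : A} (he : ‖e‖ ≤ 1) (v : X) :
    ∃ w : X, (2 / 3 : ℂ) • w + (1 / 3 : ℂ) • μ e w = v ∧ ‖w‖ ≤ 3 * ‖v‖ := by
  have hμ : ∀ x, ‖μ e x‖ ≤ ‖x‖ := fun x ↦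
    (hnorm e x).trans (mul_le_of_le_one_left (norm_nonneg x) he)
  let D : X →L[ℂ] X :=
    ((1 / 3 : ℂ) • (LinearMap.id - μ e)).mkContinuous (2 / 3) fun x ↦ by
      have h := norm_sub_le x (μ e x)
      have h' := hμ x
      simp only [LinearMap.smul_apply, LinearMap.sub_apply, LinearMap.id_apply, norm_smul]
      norm_num
      linarith
  have hD : ‖D‖ < 1 :=
    (LinearMap.mkContinuous_norm_le _ (by norm_num) _).trans_lt (by norm_num)
  have hDx : ∀ x, D x = (1 / 3 : ℂ) • (x - μ e x) := fun _ ↦ rfl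
  let u := Units.oneSub D hD
  have hu : ∀ x, (u : X →L[ℂ] X) x = x - D x := fun _ ↦ rfl
  obtain ⟨w, hw⟩ : ∃ w, w - D w = v := by
    refine ⟨(↑u⁻¹ : X →L[ℂ] X) v, ?_⟩
    rw [← hu, ← mul_apply_eq_comp, Units.mul_inv, one_apply_eq_self]
  refine ⟨w, ?_, ?_⟩
  · rw [← hw, hDx]
    module
  · have h₁ : ‖D w‖ ≤ 2 / 3 * ‖w‖ :=
      D.le_of_opNorm_le (LinearMap.mkContinuous_norm_le _ (by norm_num) _) w
    have h₂ := norm_sub_norm_le w (D w)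
    rw [hw] at h₂
    linarith

/-- `x` solves `s • x + a • x = y`, and the operator `s + a` is boundedly surjective. -/
def IsApproxFactor (μ : A →ₗ[ℂ] X →ₗ[ℂ] X) (y : X) (s : ℂ) (a : A) (x : X) : Prop :=
  s • x + μ a x = y ∧ ∃ K > (0 : ℝ), ∀ v, ∃ w, s • w + μ a w = v ∧ ‖w‖ ≤ K * ‖v‖

lemma IsApproxFactor.exists_next [CompleteSpace X] {μ : A →ₗ[ℂ] X →ₗ[ℂ] X}
    (hmul : ∀ (a b : A) (x : X), μ (a * b) x = μ a (μ b x))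
    (hnorm : ∀ (a : A) (x : X), ‖μ a x‖ ≤ ‖a‖ * ‖x‖)
    {l : Filter A} [l.NeBot] (hl : ∀ᶠ e in l, ‖e‖ ≤ 1)
    (hmem : ∀ m, Tendsto (· * m) l (𝓝 m))
    {y : X} (hy : Tendsto (fun e ↦ μ e y) l (𝓝 y))
    {s : ℂ} {a : A} {x : X} (h : IsApproxFactor μ y s a x) {ε : ℝ} (hε : 0 < ε) :
    ∃ (a' : A) (x' : X), IsApproxFactor μ y (2 / 3 * s) a' x' ∧
      ‖a' - a‖ ≤ ε + ‖s‖ ∧ ‖x' - x‖ ≤ ε := by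
  obtain ⟨hx, K, hK, hsurj⟩ := h
  obtain ⟨e, he, hea, hey⟩ := (hl.and
    (((hmem a).eventually (Metric.closedBall_mem_nhds a hε)).and
      (hy.eventually (Metric.closedBall_mem_nhds y (div_pos hε hK))))).exists
  rw [dist_eq_norm] at hea hey
  set a' : A := (2 / 3 : ℂ) • a + (1 / 3 * s) • e + (1 / 3 : ℂ) • (e * a) with ha'
  have hcomp : ∀ w, (2 / 3 * s) • w + μ a' w =
      (2 / 3 : ℂ) • (s • w + μ a w) + (1 / 3 : ℂ) • μ e (s • w + μ a w) := fun w ↦ by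
    simp only [ha', map_add, map_smul, LinearMap.add_apply, LinearMap.smul_apply, hmul]
    module
  obtain ⟨z, hz, hz'⟩ := exists_preimage_of_norm_le_one μ hnorm he ((1 / 3 : ℂ) • (y - μ e y))
  obtain ⟨d, hd, hd'⟩ := hsurj z
  refine ⟨a', x + d, ⟨?_, K * 3, by positivity, fun v ↦ ?_⟩, ?_, ?_⟩
  · have hxd : s • (x + d) + μ a (x + d) = y + z := by
      rw [← hx, ← hd, map_add]
      module
    rw [hcomp, hxd, map_add]
    linear_combination (norm := module) hz
  · obtain ⟨w, hw, hw'⟩ := exists_preimage_of_norm_le_one μ hnorm he v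
    obtain ⟨t, ht, ht'⟩ := hsurj w
    refine ⟨t, by rw [hcomp, ht, hw], ht'.trans ?_⟩
    rw [mul_assoc]
    gcongr
  · have : a' - a = (1 / 3 : ℂ) • (e * a - a) + (1 / 3 * s) • e := by
      rw [ha']
      module
    rw [this]
    refine (norm_add_le _ _).trans (add_le_add ?_ ?_)
    · rw [norm_smul]
      norm_num
      linarith
    · rw [norm_smul, norm_mul]
      norm_num
      nlinarith [norm_nonneg s, norm_nonneg e]
  · rw [add_sub_cancel_left]
    have hz'' : ‖z‖ ≤ ε / K := by
      rw [norm_smul, norm_sub_rev] at hz'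
      norm_num at hz'
      linarith
    calc ‖d‖ ≤ K * ‖z‖ := hd'
      _ ≤ K * (ε / K) := by gcongr
      _ = ε := by field_simp

/-- **Cohen's factorisation theorem** for a vector on which a contractive left approximate unit
acts as an approximate identity. -/
theorem exists_eq_apply_of_tendsto [CompleteSpace A] [CompleteSpace X] {μ : A →ₗ[ℂ] X →ₗ[ℂ] X}
    (hmul : ∀ (a b : A) (x : X), μ (a * b) x = μ a (μ b x))
    (hnorm : ∀ (a : A) (x : X), ‖μ a x‖ ≤ ‖a‖ * ‖x‖)
    {l : Filter A} [l.NeBot] (hl : ∀ᶠ e in l, ‖e‖ ≤ 1)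
    (hmem : ∀ m, Tendsto (· * m) l (𝓝 m))
    {y : X} (hy : Tendsto (fun e ↦ μ e y) l (𝓝 y)) :
    ∃ (a : A) (x : X), y = μ a x := by
  have hstart : IsApproxFactor μ y ((2 / 3) ^ 0) 0 y :=
    ⟨by simp, 1, one_pos, fun v ↦ ⟨v, by simp, by simp⟩⟩
  have hstep : ∀ (n : ℕ) (p : A × X), IsApproxFactor μ y ((2 / 3) ^ n) p.1 p.2 →
      ∃ q : A × X, IsApproxFactor μ y ((2 / 3) ^ (n + 1)) q.1 q.2 ∧
        ‖q.1 - p.1‖ ≤ 2 * (2 / 3) ^ n ∧ ‖q.2 - p.2‖ ≤ 1 * (2 / 3) ^ n := fun n p hp ↦ by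
    obtain ⟨a', x', h, ha, hx⟩ := hp.exists_next hmul hnorm hl hmem hy
      (ε := (2 / 3) ^ n) (by positivity)
    refine ⟨(a', x'), by rwa [pow_succ'], ha.trans_eq ?_, hx.trans_eq (one_mul _).symm⟩
    norm_num
    ring
  choose! next hnext using hstep
  let p : ℕ → A × X := fun n ↦ Nat.rec (0, y) next n
  have hp : ∀ n, IsApproxFactor μ y ((2 / 3) ^ n) (p n).1 (p n).2 := fun n ↦ by
    induction n with
    | zero => exact hstart
    | succ n ih => exact (hnext n _ ih).1
  obtain ⟨a, ha⟩ := cauchySeq_tendsto_of_complete <|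
    cauchySeq_of_le_geometric (2 / 3) 2 (by norm_num) (f := fun n ↦ (p n).1) fun n ↦ by
      rw [dist_eq_norm, norm_sub_rev]
      exact (hnext n _ (hp n)).2.1
  obtain ⟨x, hx⟩ := cauchySeq_tendsto_of_complete <|
    cauchySeq_of_le_geometric (2 / 3) 1 (by norm_num) (f := fun n ↦ (p n).2) fun n ↦ by
      rw [dist_eq_norm, norm_sub_rev]
      exact (hnext n _ (hp n)).2.2
  refine ⟨a, x, tendsto_nhds_unique (f := fun _ : ℕ ↦ y) (l := atTop) tendsto_const_nhds ?_⟩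
  have hcont : Tendsto (fun n ↦ μ (p n).1 (p n).2) atTop (𝓝 (μ a x)) :=
    ((LinearMap.mkContinuous₂ μ 1 (by simpa using hnorm)).continuous₂.tendsto (a, x)).comp
      (ha.prodMk_nhds hx)
  have hs : Tendsto (fun n : ℕ ↦ ((2 / 3 : ℂ) ^ n)) atTop (𝓝 0) :=
    tendsto_pow_atTop_nhds_zero_of_norm_lt_one (by norm_num)
  have hlim := (hs.smul hx).add hcont
  rw [zero_smul, zero_add] at hlim
  exact hlim.congr fun n ↦ (hp n).1

lemma tendsto_apply_of_mem_closure_span {μ : A →ₗ[ℂ] X →ₗ[ℂ] X}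
    (hmul : ∀ (a b : A) (x : X), μ (a * b) x = μ a (μ b x))
    (hnorm : ∀ (a : A) (x : X), ‖μ a x‖ ≤ ‖a‖ * ‖x‖)
    {l : Filter A} (hl : ∀ᶠ e in l, ‖e‖ ≤ 1) (hmem : ∀ m, Tendsto (· * m) l (𝓝 m))
    {y : X} (hy : y ∈ (Submodule.span ℂ {y | ∃ a x, y = μ a x}).topologicalClosure) :
    Tendsto (fun e ↦ μ e y) l (𝓝 y) := by
  have hspan : ∀ z ∈ Submodule.span ℂ {y | ∃ a x, y = μ a x},
      Tendsto (fun e ↦ μ e z) l (𝓝 z) := fun z hz ↦ by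
    induction hz using Submodule.span_induction with
    | mem z hz =>
      obtain ⟨a, x, rfl⟩ := hz
      simp_rw [← hmul]
      exact ((LinearMap.mkContinuous₂ μ 1 (by simpa using hnorm)).flip x).continuous.tendsto a
        |>.comp (hmem a)
    | zero => simpa using tendsto_const_nhds
    | add u v _ _ hu hv => simpa using hu.add hv
    | smul c u _ hu => simpa using hu.const_smul c
  rw [Metric.tendsto_nhds]
  intro ε hε
  obtain ⟨z, hz, hyz⟩ := Metric.mem_closure_iff.mp hy (ε / 3) (by positivity)
  filter_upwards [hl, Metric.tendsto_nhds.mp (hspan z hz) (ε / 3) (by positivity)] with e he hez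
  have h₁ : dist (μ e y) (μ e z) ≤ dist y z := by
    rw [dist_eq_norm, dist_eq_norm, ← map_sub]
    exact (hnorm e _).trans (mul_le_of_le_one_left (norm_nonneg _) he)
  have h₂ := dist_triangle4 (μ e y) (μ e z) z y
  rw [dist_comm z y] at h₂
  linarith

end Factorisation


/-- **Cohen–Hewitt factorisation.** If `A` is a C*-algebra and `X` a Banach space that is a
left Banach `A`-module (action ℂ-bilinear, contractive), then `A • X = {a • x}` is a closed
`A`-submodule of `X`: in particular it is a ℂ-submodule closed under the `A`-action, closed
under addition, and closed in the norm topology. -/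
theorem cohen_hewitt_factorisation
    {A : Type} [NonUnitalCStarAlgebra A]
    {X : Type} [NormedAddCommGroup X] [NormedSpace ℂ X] [CompleteSpace X]
    (μ : A →ₗ[ℂ] X →ₗ[ℂ] X)
    (hmul : ∀ (a b : A) (x : X), μ (a * b) x = μ a (μ b x))
    (hnorm : ∀ (a : A) (x : X), ‖μ a x‖ ≤ ‖a‖ * ‖x‖) :
    ∃ S : Submodule ℂ X,
      (S : Set X) = {y : X | ∃ (a : A) (x : X), y = μ a x} ∧
      IsClosed (S : Set X) ∧
      ∀ (a : A), ∀ y ∈ S, μ a y ∈ S := by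
  let _ := CStarAlgebra.spectralOrder A
  have := CStarAlgebra.spectralOrderedRing A
  have hu := CStarAlgebra.increasingApproximateUnit A
  have hset : ((Submodule.span ℂ {y | ∃ a x, y = μ a x}).topologicalClosure : Set X) =
      {y : X | ∃ (a : A) (x : X), y = μ a x} := by
    refine Set.Subset.antisymm (fun y hy ↦ ?_)
      (Submodule.subset_span.trans (Submodule.le_topologicalClosure _))
    exact exists_eq_apply_of_tendsto hmul hnorm hu.eventually_norm hu.tendsto_mul_right
      (tendsto_apply_of_mem_closure_span hmul hnorm hu.eventually_norm hu.tendsto_mul_right hy)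
  refine ⟨_, hset, Submodule.isClosed_topologicalClosure _, fun a y _ ↦ ?_⟩
  rw [← SetLike.mem_coe, hset]
  exact ⟨a, y, rfl⟩
end

section
/- Let H be a nonzero complex Hilbert space and let S be a (not necessarily closed or unital) ℂ-subalgebra of B(H) that is closed under taking adjoints. Then the following are equivalent: (i) the only closed subspaces V of H with s(V) ⊆ V for every s ∈ S are 0 and H; (ii) every bounded operator T ∈ B(H) satisfying T s = s T for all s ∈ S is a scalar multiple of the identity operator. -/
namespace ContinuousLinearMap

/-- An orthogonal projection onto an invariant subspace of both `s` and `star s` commutes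
with `s`. -/
theorem commute_starProjection {H : Type*} [NormedAddCommGroup H] [InnerProductSpace ℂ H]
    [CompleteSpace H] {V : Submodule ℂ H} [V.HasOrthogonalProjection] {s : H →L[ℂ] H}
    (hs : ∀ v ∈ V, s v ∈ V) (hs' : ∀ v ∈ V, star s v ∈ V) : Commute V.starProjection s := by
  rw [IsIdempotentElem.commute_iff V.isIdempotentElem_starProjection, V.range_starProjection,
    V.ker_starProjection]
  exact ⟨hs, orthogonal_mem_invtSubmodule hs'⟩

/-- A product of operators can vanish only if one of the factors does, provided that the left
factor commutes with a set of operators without nontrivial closed invariant subspaces. -/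
theorem eq_zero_or_eq_zero_of_mul_eq_zero_of_irreducible {H : Type*} [NormedAddCommGroup H]
    [InnerProductSpace ℂ H] {S : Set (H →L[ℂ] H)}
    (hS : ∀ V : Submodule ℂ H, IsClosed (V : Set H) → (∀ s ∈ S, ∀ v ∈ V, s v ∈ V) →
      V = ⊥ ∨ V = ⊤)
    {p q : H →L[ℂ] H} (hp : ∀ s ∈ S, Commute p s) (hpq : p * q = 0) : p = 0 ∨ q = 0 := by
  have key := hS p.ker p.isClosed_ker fun s hs v hv ↦ by
    have h : p (s v) = s (p v) := DFunLike.congr_fun (hp s hs) v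
    have hv : p v = 0 := hv
    change p (s v) = 0
    rw [h, hv, map_zero]
  rcases key with h | h
  · right
    ext x
    have hx : q x ∈ p.ker := DFunLike.congr_fun hpq x
    simpa [h] using hx
  · left
    ext x
    have hx : x ∈ p.ker := h ▸ Submodule.mem_top
    exact hx

/-- A self-adjoint operator commuting with a set of operators without nontrivial closed invariant
subspaces is a scalar. -/
theorem _root_.IsSelfAdjoint.exists_eq_smul_one_of_irreducible {H : Type*} [NormedAddCommGroup H]
    [InnerProductSpace ℂ H] [CompleteSpace H] [Nontrivial H] {S : Set (H →L[ℂ] H)}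
    (hS : ∀ V : Submodule ℂ H, IsClosed (V : Set H) → (∀ s ∈ S, ∀ v ∈ V, s v ∈ V) →
      V = ⊥ ∨ V = ⊤)
    {a : H →L[ℂ] H} (ha : IsSelfAdjoint a) (hc : ∀ s ∈ S, Commute a s) :
    ∃ r : ℝ, a = (r : ℂ) • (1 : H →L[ℂ] H) := by
  have spectrum_not_lt : ∀ x ∈ spectrum ℝ a, ∀ y ∈ spectrum ℝ a, ¬ x < y := by
    intro x hx y hy hxy
    obtain ⟨m, hxm, hmy⟩ := exists_between hxy
    have ne_zero (f : ℝ → ℝ) (hf : Continuous f) {z : ℝ} (hz : z ∈ spectrum ℝ a)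
        (hfz : f z ≠ 0) : cfc f a ≠ 0 := by
      intro h
      have hmem : f z ∈ spectrum ℝ (cfc f a) := by
        rw [cfc_map_spectrum f a ha hf.continuousOn]
        exact ⟨z, hz, rfl⟩
      rw [h, spectrum.zero_eq] at hmem
      exact hfz hmem
    have hmul : cfc (fun t : ℝ ↦ max (t - m) 0) a * cfc (fun t : ℝ ↦ max (m - t) 0) a = 0 := by
      rw [← cfc_mul .., ← cfc_const_zero ℝ a]
      congr 1
      ext t
      rcases le_total t m with h | h
      · rw [max_eq_right (sub_nonpos.2 h), zero_mul]
      · rw [max_eq_right (sub_nonpos.2 h), mul_zero]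
    rcases eq_zero_or_eq_zero_of_mul_eq_zero_of_irreducible hS
      (fun s hs ↦ (hc s hs).cfc_real _) hmul with h | h
    · exact ne_zero (fun t : ℝ ↦ max (t - m) 0) (by fun_prop) hy
        (lt_max_of_lt_left (sub_pos.2 hmy)).ne' h
    · exact ne_zero (fun t : ℝ ↦ max (m - t) 0) (by fun_prop) hx
        (lt_max_of_lt_left (sub_pos.2 hxm)).ne' h
  obtain ⟨r, hr⟩ := ContinuousFunctionalCalculus.spectrum_nonempty (R := ℝ) a ha
  refine ⟨r, ?_⟩
  rw [CFC.eq_algebraMap_of_spectrum_subset_singleton a r fun x hx ↦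
    le_antisymm (not_lt.1 (spectrum_not_lt r hr x hx)) (not_lt.1 (spectrum_not_lt x hx r hr)),
    Algebra.algebraMap_eq_smul_one, Complex.coe_smul]

end ContinuousLinearMap

/-- A (not necessarily closed or unital) star-closed ℂ-subalgebra `S ⊆ B(H)` of bounded operators
on a nonzero complex Hilbert space `H` acts irreducibly (the only closed invariant subspaces are
`0` and `H`) if and only if its commutant consists of the scalar multiples of the identity. -/
theorem irreducible_iff_commutant_trivial
    {H : Type} [NormedAddCommGroup H] [InnerProductSpace ℂ H] [CompleteSpace H] [Nontrivial H]
    (S : Set (H →L[ℂ] H))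
    (h_add : ∀ s ∈ S, ∀ t ∈ S, s + t ∈ S)
    (h_smul : ∀ (c : ℂ), ∀ s ∈ S, c • s ∈ S)
    (h_mul : ∀ s ∈ S, ∀ t ∈ S, s * t ∈ S)
    (h_star : ∀ s ∈ S, star s ∈ S) :
    (∀ V : Submodule ℂ H, IsClosed (V : Set H) →
        (∀ s ∈ S, ∀ v ∈ V, s v ∈ V) → V = ⊥ ∨ V = ⊤) ↔
    (∀ T : H →L[ℂ] H, (∀ s ∈ S, T * s = s * T) →
        ∃ c : ℂ, T = c • (1 : H →L[ℂ] H)) := by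
  constructor
  · intro hS T hT
    have hcomm (s) (hs : s ∈ S) : Commute T s := hT s hs
    have hcomm' (s) (hs : s ∈ S) : Commute (star T) s := by
      simpa using (hcomm _ (h_star s hs)).star_star
    have hre : ∀ s ∈ S, Commute (realPart T : H →L[ℂ] H) s := fun s hs ↦ by
      rw [realPart_apply_coe]
      exact ((hcomm s hs).add_left (hcomm' s hs)).smul_left _
    have him : ∀ s ∈ S, Commute (imaginaryPart T : H →L[ℂ] H) s := fun s hs ↦ by
      rw [imaginaryPart_apply_coe]
      exact (((hcomm s hs).sub_left (hcomm' s hs)).smul_left _).smul_left _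
    obtain ⟨x, hx⟩ := (realPart T).2.exists_eq_smul_one_of_irreducible hS hre
    obtain ⟨y, hy⟩ := (imaginaryPart T).2.exists_eq_smul_one_of_irreducible hS him
    refine ⟨x + Complex.I * y, ?_⟩
    rw [← realPart_add_I_smul_imaginaryPart T, hx, hy, smul_smul, add_smul]
  · intro hS V hV hinv
    have : CompleteSpace V := hV.completeSpace_coe
    obtain ⟨c, hc⟩ := hS V.starProjection fun s hs ↦
      ContinuousLinearMap.commute_starProjection (hinv s hs) (hinv _ (h_star s hs))
    rw [or_iff_not_imp_left, Submodule.eq_bot_iff, Submodule.eq_top_iff']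
    intro hne
    push Not at hne
    obtain ⟨v, hv, hv0⟩ := hne
    have hcv (x : H) : V.starProjection x = c • x := DFunLike.congr_fun hc x
    have hc1 : c = 1 := by
      have h := hcv v
      rw [Submodule.starProjection_eq_self_iff.2 hv] at h
      exact smul_left_injective ℂ hv0 (by simpa using h.symm)
    intro x
    rw [← Submodule.starProjection_eq_self_iff, hcv, hc1, one_smul]
end

section
/- Let H be a nonzero complex Hilbert space and let S be a ℂ-subalgebra of B(H) that is closed under taking adjoints, with S ≠ {0}, and such that the only closed subspaces of H invariant under every element of S are 0 and H. Then S is dense in B(H) in the strong operator topology: for every T ∈ B(H), every finite family of vectors ξ₁, …, ξₙ ∈ H, and every ε > 0, there exists s ∈ S with ‖(s − T)ξᵢ‖ < ε for all i = 1, …, n. -/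
section Irreducible

variable {H : Type*} [NormedAddCommGroup H] [InnerProductSpace ℂ H]

/-- The diagonal action of an operator on a finite Hilbert sum of copies of `H`. -/
noncomputable def diagonalCLM (ι : Type*) [Fintype ι] (s : H →L[ℂ] H) :
    PiLp 2 (fun _ : ι => H) →L[ℂ] PiLp 2 (fun _ : ι => H) :=
  ((PiLp.continuousLinearEquiv 2 ℂ (fun _ : ι => H)).symm : _ →L[ℂ] _) ∘L
    ContinuousLinearMap.pi fun i => s ∘L PiLp.proj 2 (fun _ : ι => H) i

@[simp]
lemma diagonalCLM_apply {ι : Type*} [Fintype ι] (s : H →L[ℂ] H)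
    (x : PiLp 2 (fun _ : ι => H)) (i : ι) : diagonalCLM ι s x i = s (x i) := rfl

lemma inner_diagonalCLM_left [CompleteSpace H] {ι : Type*} [Fintype ι] (s : H →L[ℂ] H)
    (x y : PiLp 2 (fun _ : ι => H)) :
    inner ℂ (diagonalCLM ι s x) y = inner ℂ x (diagonalCLM ι (star s) y) := by
  simp [PiLp.inner_apply, ContinuousLinearMap.star_eq_adjoint,
    ContinuousLinearMap.adjoint_inner_right]

/-- The projection onto a closed subspace commutes with every diagonal operator that, together
with its adjoint, preserves the subspace. -/
lemma starProjection_diagonalCLM [CompleteSpace H] {ι : Type*} [Fintype ι]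
    (K : Submodule ℂ (PiLp 2 (fun _ : ι => H))) [K.HasOrthogonalProjection] (s : H →L[ℂ] H)
    (hs : ∀ x ∈ K, diagonalCLM ι s x ∈ K) (hs' : ∀ x ∈ K, diagonalCLM ι (star s) x ∈ K)
    (x : PiLp 2 (fun _ : ι => H)) :
    K.starProjection (diagonalCLM ι s x) = diagonalCLM ι s (K.starProjection x) := by
  refine Submodule.eq_starProjection_of_mem_orthogonal
    (hs _ (K.starProjection_apply_mem x)) ?_
  rw [← map_sub, Submodule.mem_orthogonal']
  intro u hu
  rw [inner_diagonalCLM_left]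
  exact Submodule.inner_left_of_mem_orthogonal (hs' u hu) (K.sub_starProjection_mem_orthogonal x)

/-- **Schur's lemma**, self-adjoint case. -/
lemma IsSelfAdjoint.exists_eq_smul_one_of_commute [CompleteSpace H] [Nontrivial H]
    {S : Set (H →L[ℂ] H)}
    (h_irr : ∀ V : Submodule ℂ H, IsClosed (V : Set H) →
      (∀ s ∈ S, ∀ v ∈ V, s v ∈ V) → V = ⊥ ∨ V = ⊤)
    {A : H →L[ℂ] H} (hA : IsSelfAdjoint A) (hc : ∀ s ∈ S, Commute A s) :
    ∃ c : ℂ, A = c • (1 : H →L[ℂ] H) := by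
  have spectrum_image : ∀ f : ℝ → ℝ, Continuous f → cfc f A = 0 →
      ∀ x ∈ spectrum ℝ A, f x = 0 := by
    intro f hf h0 x hx
    have h := cfc_map_spectrum f A hA hf.continuousOn
    rw [h0, spectrum.zero_eq] at h
    have : f x ∈ f '' spectrum ℝ A := ⟨x, hx, rfl⟩
    rw [← h] at this
    exact this
  have disjoint_supports : ∀ f g : ℝ → ℝ, Continuous f → Continuous g → (∀ x, f x * g x = 0) →
      cfc f A = 0 ∨ cfc g A = 0 := by
    intro f g hf hg hfg
    have hmul : cfc f A * cfc g A = 0 := by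
      rw [← cfc_mul f g A hf.continuousOn hg.continuousOn]
      simp [hfg]
    have invariant : ∀ s ∈ S, ∀ v ∈ LinearMap.ker (cfc f A : H →L[ℂ] H).toLinearMap,
        s v ∈ LinearMap.ker (cfc f A : H →L[ℂ] H).toLinearMap := by
      intro s hs v hv
      have h1 : cfc f A (s v) = s (cfc f A v) :=
        DFunLike.congr_fun ((hc s hs).cfc_real f).eq v
      have h2 : cfc f A v = 0 := hv
      change cfc f A (s v) = 0
      rw [h1, h2, map_zero]
    rcases h_irr _ (cfc f A).isClosed_ker invariant with h | h
    · right
      ext v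
      have hv : cfc g A v ∈ LinearMap.ker (cfc f A : H →L[ℂ] H).toLinearMap :=
        DFunLike.congr_fun hmul v
      rw [h] at hv
      exact hv
    · left
      ext v
      have hv : v ∈ LinearMap.ker (cfc f A : H →L[ℂ] H).toLinearMap := h ▸ Submodule.mem_top
      exact hv
  have no_gap : ∀ a ∈ spectrum ℝ A, ∀ b ∈ spectrum ℝ A, ¬ a < b := by
    intro a ha b hb hab
    have hmul : ∀ x : ℝ, max ((a + b) / 2 - x) 0 * max (x - (a + b) / 2) 0 = 0 := by
      intro x
      rcases le_total x ((a + b) / 2) with h | h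
      · simp [max_eq_right (sub_nonpos.2 h)]
      · simp [max_eq_right (sub_nonpos.2 h)]
    rcases disjoint_supports (fun x => max ((a + b) / 2 - x) 0) (fun x => max (x - (a + b) / 2) 0)
      (by fun_prop) (by fun_prop) hmul with h | h
    · have := spectrum_image _ (by fun_prop) h a ha
      have := le_max_left ((a + b) / 2 - a) 0
      linarith
    · have := spectrum_image _ (by fun_prop) h b hb
      have := le_max_left (b - (a + b) / 2) 0
      linarith
  obtain ⟨a, ha⟩ := ContinuousFunctionalCalculus.spectrum_nonempty (R := ℝ) A hA
  refine ⟨a, ?_⟩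
  have heq : Set.EqOn (id : ℝ → ℝ) (fun _ => a) (spectrum ℝ A) := fun b hb =>
    le_antisymm (not_lt.1 (no_gap a ha b hb)) (not_lt.1 (no_gap b hb a ha))
  rw [← cfc_id ℝ A hA, cfc_congr heq, cfc_const a A hA, Algebra.algebraMap_eq_smul_one]
  exact (Complex.coe_smul a _).symm

/-- **Schur's lemma**: an operator commuting with an irreducible star-closed set of operators is
a scalar. -/
lemma exists_eq_smul_one_of_commute [CompleteSpace H] [Nontrivial H]
    {S : Set (H →L[ℂ] H)} (h_star : ∀ s ∈ S, star s ∈ S)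
    (h_irr : ∀ V : Submodule ℂ H, IsClosed (V : Set H) →
      (∀ s ∈ S, ∀ v ∈ V, s v ∈ V) → V = ⊥ ∨ V = ⊤)
    {A : H →L[ℂ] H} (hc : ∀ s ∈ S, Commute A s) :
    ∃ c : ℂ, A = c • (1 : H →L[ℂ] H) := by
  have hc' : ∀ s ∈ S, Commute (star A) s := fun s hs => by
    simpa using (hc (star s) (h_star s hs)).star_star
  obtain ⟨a, ha⟩ := (realPart A).2.exists_eq_smul_one_of_commute h_irr fun s hs => by
    rw [realPart_apply_coe]
    exact ((hc s hs).add_left (hc' s hs)).smul_left _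
  obtain ⟨b, hb⟩ := (imaginaryPart A).2.exists_eq_smul_one_of_commute h_irr fun s hs => by
    rw [imaginaryPart_apply_coe]
    exact (((hc s hs).sub_left (hc' s hs)).smul_left _).smul_left _
  refine ⟨a + Complex.I * b, ?_⟩
  rw [← realPart_add_I_smul_imaginaryPart A, ha, hb, add_smul, mul_smul]

/-- An operator on a finite Hilbert sum commuting with the diagonal action of an irreducible
star-closed set commutes with all diagonal operators. -/
lemma commute_diagonalCLM_of_irreducible [CompleteSpace H] [Nontrivial H] {ι : Type*} [Fintype ι]
    {S : Set (H →L[ℂ] H)} (h_star : ∀ s ∈ S, star s ∈ S)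
    (h_irr : ∀ V : Submodule ℂ H, IsClosed (V : Set H) →
      (∀ s ∈ S, ∀ v ∈ V, s v ∈ V) → V = ⊥ ∨ V = ⊤)
    {P : PiLp 2 (fun _ : ι => H) →L[ℂ] PiLp 2 (fun _ : ι => H)}
    (hP : ∀ s ∈ S, ∀ x, P (diagonalCLM ι s x) = diagonalCLM ι s (P x))
    (T : H →L[ℂ] H) (x : PiLp 2 (fun _ : ι => H)) :
    P (diagonalCLM ι T x) = diagonalCLM ι T (P x) := by
  classical
  let E (i j : ι) : H →L[ℂ] H := PiLp.proj 2 (fun _ : ι => H) i ∘L P ∘L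
    ((PiLp.continuousLinearEquiv 2 ℂ (fun _ : ι => H)).symm : _ →L[ℂ] _) ∘L
    ContinuousLinearMap.single ℂ (fun _ : ι => H) j
  have E_apply (i j : ι) (v : H) : E i j v = P (PiLp.single 2 j v) i := rfl
  have diag_single (s : H →L[ℂ] H) (j : ι) (v : H) :
      diagonalCLM ι s (PiLp.single 2 j v) = PiLp.single 2 j (s v) := by
    ext i
    by_cases h : i = j
    · subst h; simp
    · simp [h]
  have hE (i j : ι) : ∃ c : ℂ, E i j = c • (1 : H →L[ℂ] H) := by
    refine exists_eq_smul_one_of_commute h_star h_irr fun s hs => ?_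
    ext v
    change E i j (s v) = s (E i j v)
    rw [E_apply, E_apply, ← diag_single, hP s hs, diagonalCLM_apply]
  have sum_single (y : PiLp 2 (fun _ : ι => H)) : y = ∑ j, PiLp.single 2 j (y j) := by
    ext i
    simp [Pi.single_apply]
  have P_apply (y : PiLp 2 (fun _ : ι => H)) (i : ι) : P y i = ∑ j, E i j (y j) := by
    conv_lhs => rw [sum_single y, map_sum]
    simp [E_apply]
  ext i
  rw [diagonalCLM_apply, P_apply, P_apply, map_sum]
  refine Finset.sum_congr rfl fun j _ => ?_
  obtain ⟨c, hc⟩ := hE i j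
  simp [hc]

/-- A nonzero irreducible set of operators has no common null vector. -/
lemma eq_zero_of_forall_apply_eq_zero {S : Set (H →L[ℂ] H)}
    (h_zero : (0 : H →L[ℂ] H) ∈ S) (h_ne : S ≠ {0})
    (h_irr : ∀ V : Submodule ℂ H, IsClosed (V : Set H) →
      (∀ s ∈ S, ∀ v ∈ V, s v ∈ V) → V = ⊥ ∨ V = ⊤)
    {v : H} (hv : ∀ s ∈ S, s v = 0) : v = 0 := by
  let N : Submodule ℂ H := ⨅ s ∈ S, LinearMap.ker s.toLinearMap
  have mem_N (w : H) : w ∈ N ↔ ∀ s ∈ S, s w = 0 := by simp [N]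
  have hN : IsClosed (N : Set H) := by
    have : (N : Set H) = ⋂ s ∈ S, {w | s w = 0} := by
      ext w
      simp [mem_N]
    rw [this]
    exact isClosed_biInter fun s _ => isClosed_eq s.continuous continuous_const
  rcases h_irr N hN fun s hs w hw => by rw [(mem_N w).1 hw s hs]; exact N.zero_mem with h | h
  · have := (mem_N v).2 hv
    rw [h] at this
    exact this
  · refine absurd (Set.eq_singleton_iff_unique_mem.2 ⟨h_zero, fun s hs => ?_⟩) h_ne
    ext w
    exact (mem_N w).1 (h ▸ Submodule.mem_top) s hs

end Irreducible

/-- A nonzero star-closed ℂ-subalgebra `S ⊆ B(H)` acting irreducibly on a nonzero complex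
Hilbert space `H` is dense in `B(H)` in the strong operator topology. -/
theorem irreducible_subalgebra_SOT_dense
    {H : Type} [NormedAddCommGroup H] [InnerProductSpace ℂ H] [CompleteSpace H] [Nontrivial H]
    (S : Set (H →L[ℂ] H))
    (h_zero : (0 : H →L[ℂ] H) ∈ S)
    (h_add : ∀ s ∈ S, ∀ t ∈ S, s + t ∈ S)
    (h_smul : ∀ (c : ℂ), ∀ s ∈ S, c • s ∈ S)
    (h_mul : ∀ s ∈ S, ∀ t ∈ S, s * t ∈ S)
    (h_star : ∀ s ∈ S, star s ∈ S)
    (h_ne : S ≠ {0})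
    (h_irr : ∀ V : Submodule ℂ H, IsClosed (V : Set H) →
        (∀ s ∈ S, ∀ v ∈ V, s v ∈ V) → V = ⊥ ∨ V = ⊤) :
    ∀ T : H →L[ℂ] H, ∀ n : ℕ, ∀ ξ : Fin n → H, ∀ ε : ℝ, 0 < ε →
      ∃ s ∈ S, ∀ i : Fin n, ‖(s - T) (ξ i)‖ < ε := by
  intro T n ξ ε hε
  let x : PiLp 2 (fun _ : Fin n => H) := WithLp.toLp 2 ξ
  let K₀ : Submodule ℂ (PiLp 2 (fun _ : Fin n => H)) :=
    { carrier := (fun s => diagonalCLM (Fin n) s x) '' S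
      add_mem' := by
        rintro _ _ ⟨s, hs, rfl⟩ ⟨t, ht, rfl⟩
        exact ⟨s + t, h_add s hs t ht, rfl⟩
      zero_mem' := ⟨0, h_zero, rfl⟩
      smul_mem' := by
        rintro c _ ⟨s, hs, rfl⟩
        exact ⟨c • s, h_smul c s hs, rfl⟩ }
  let K := K₀.topologicalClosure
  have : CompleteSpace K := K₀.isClosed_topologicalClosure.completeSpace_coe
  have hK : ∀ s ∈ S, ∀ y ∈ K, diagonalCLM (Fin n) s y ∈ K := by
    intro s hs y hy
    refine map_mem_closure (diagonalCLM (Fin n) s).continuous hy ?_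
    rintro _ ⟨t, ht, rfl⟩
    exact ⟨s * t, h_mul s hs t ht, rfl⟩
  have hP : ∀ s ∈ S, ∀ y, K.starProjection (diagonalCLM (Fin n) s y) =
      diagonalCLM (Fin n) s (K.starProjection y) := fun s hs =>
    starProjection_diagonalCLM K s (hK s hs) (hK _ (h_star s hs))
  have hx : K.starProjection x = x := by
    refine (sub_eq_zero.1 ?_).symm
    ext i
    refine eq_zero_of_forall_apply_eq_zero h_zero h_ne h_irr fun s hs => ?_
    have hsx : diagonalCLM (Fin n) s x ∈ K := K₀.le_topologicalClosure ⟨s, hs, rfl⟩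
    rw [← diagonalCLM_apply, map_sub, ← hP s hs, Submodule.starProjection_eq_self_iff.2 hsx,
      sub_self]
    rfl
  have hT : diagonalCLM (Fin n) T x ∈ K := by
    rw [← Submodule.starProjection_eq_self_iff,
      commute_diagonalCLM_of_irreducible h_star h_irr hP, hx]
  obtain ⟨_, ⟨s, hs, rfl⟩, hsT⟩ := Metric.mem_closure_iff.1 hT ε hε
  refine ⟨s, hs, fun i => lt_of_le_of_lt ?_ hsT⟩
  rw [dist_comm, dist_eq_norm]
  exact PiLp.norm_apply_le (diagonalCLM (Fin n) s x - diagonalCLM (Fin n) T x) i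
end

section
/- Let A be a C*-algebra, let J ⊆ A be a norm-closed two-sided ideal, let π₁ : A → B(H₁) and π₂ : A → B(H₂) be representations of A on complex Hilbert spaces, with π₁ irreducible and with π₁(j₀) ≠ 0 for some j₀ ∈ J. Suppose u : H₁ → H₂ is a unitary operator such that u ∘ π₁(j) = π₂(j) ∘ u for all j ∈ J. Then u ∘ π₁(a) = π₂(a) ∘ u for all a ∈ A. -/
/-- If `π₁, π₂` are representations of a C*-algebra `A`, with `π₁` irreducible and nonzero on a
norm-closed two-sided ideal `J`, then any unitary `u : H₁ → H₂` intertwining `π₁` and `π₂` on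
`J` intertwines them on all of `A`. -/
theorem intertwiner_on_ideal_extends
    {A : Type} [NonUnitalCStarAlgebra A]
    {H₁ : Type} [NormedAddCommGroup H₁] [InnerProductSpace ℂ H₁] [CompleteSpace H₁] [Nontrivial H₁]
    {H₂ : Type} [NormedAddCommGroup H₂] [InnerProductSpace ℂ H₂] [CompleteSpace H₂]
    (J : Set A) (hJ_closed : IsClosed J)
    (hJ_add : ∀ x ∈ J, ∀ y ∈ J, x + y ∈ J)
    (hJ_neg : ∀ x ∈ J, -x ∈ J)
    (hJ_left : ∀ (a : A), ∀ x ∈ J, a * x ∈ J)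
    (hJ_right : ∀ (a : A), ∀ x ∈ J, x * a ∈ J)
    (π₁ : A →⋆ₙₐ[ℂ] (H₁ →L[ℂ] H₁))
    (π₂ : A →⋆ₙₐ[ℂ] (H₂ →L[ℂ] H₂))
    (h_irr : ∀ V : Submodule ℂ H₁, IsClosed (V : Set H₁) →
        (∀ a : A, ∀ v ∈ V, π₁ a v ∈ V) → V = ⊥ ∨ V = ⊤)
    (h_nonzero : ∃ j₀ ∈ J, π₁ j₀ ≠ 0)
    (u : H₁ ≃ₗᵢ[ℂ] H₂)
    (h_intertwine : ∀ j ∈ J, ∀ ξ : H₁, u (π₁ j ξ) = π₂ j (u ξ)) :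
    ∀ a : A, ∀ ξ : H₁, u (π₁ a ξ) = π₂ a (u ξ) := by
  let W : Submodule ℂ H₁ :=
    { carrier := {ξ | ∀ a : A, u (π₁ a ξ) = π₂ a (u ξ)}
      add_mem' := fun hx hy a => by simp [hx a, hy a]
      zero_mem' := fun a => by simp
      smul_mem' := fun c x hx a => by simp [hx a] }
  have hW_closed : IsClosed (W : Set H₁) := by
    have h : (W : Set H₁) = ⋂ a : A, {ξ | u (π₁ a ξ) = π₂ a (u ξ)} := by
      ext ξ
      simp [W]
    rw [h]
    exact isClosed_iInter fun a => isClosed_eq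
      (u.continuous.comp (π₁ a).continuous) ((π₂ a).continuous.comp u.continuous)
  have hW_invariant : ∀ a : A, ∀ v ∈ W, π₁ a v ∈ W := by
    intro b v hv a
    have h := hv (a * b)
    rw [map_mul, map_mul] at h
    rw [hv b]
    exact h
  rcases h_irr W hW_closed hW_invariant with h_bot | h_top
  · obtain ⟨j, hj, hj_ne⟩ := h_nonzero
    refine absurd (ContinuousLinearMap.ext fun v => ?_) hj_ne
    have hv : π₁ j v ∈ W := by
      intro a
      have h := h_intertwine (a * j) (hJ_left a j hj) v
      rw [map_mul, map_mul] at h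
      rw [h_intertwine j hj v]
      exact h
    rw [h_bot] at hv
    exact hv
  · intro a ξ
    have hξ : ξ ∈ W := h_top ▸ Submodule.mem_top
    exact hξ a
end

section
/- Let H and H' be complex Hilbert spaces with H ≠ 0, and let π be a nonzero star-algebra homomorphism from K(H) to B(H') which is irreducible, meaning H' ≠ 0 and the only closed subspaces of H' invariant under π(k) for every compact operator k on H are 0 and H'. Then π is unitarily equivalent to the identity representation of K(H): there exists a unitary operator u : H → H' such that π(k) = u ∘ k ∘ u⁻¹ for every compact operator k on H. -/
open InnerProductSpace in
theorem InnerProductSpace.isCompactOperator_rankOne {E F : Type*}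
    [NormedAddCommGroup E] [InnerProductSpace ℂ E] [NormedAddCommGroup F] [InnerProductSpace ℂ F]
    (x : E) (y : F) : IsCompactOperator (rankOne ℂ x y) := by
  rw [rankOne_def']
  exact (isCompactOperator_of_locallyCompactSpace_dom (innerSL ℂ y)).clm_comp
    (.toSpanSingleton ℂ x)

theorem Submodule.isCompactOperator_starProjection {E : Type*} [NormedAddCommGroup E]
    [InnerProductSpace ℂ E] (U : Submodule ℂ E) [FiniteDimensional ℂ U] :
    IsCompactOperator U.starProjection :=
  (isCompactOperator_of_locallyCompactSpace_dom U.orthogonalProjectionOnto).clm_comp U.subtypeL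

/-- A compact operator into an inner product space is approximated in norm by its compressions to
finite-dimensional subspaces of the codomain. -/
theorem IsCompactOperator.exists_norm_sub_starProjection_comp_le {E F : Type*}
    [NormedAddCommGroup E] [InnerProductSpace ℂ E] [NormedAddCommGroup F] [InnerProductSpace ℂ F]
    {k : E →L[ℂ] F} (hk : IsCompactOperator k) {ε : ℝ} (hε : 0 < ε) :
    ∃ (U : Submodule ℂ F) (_ : FiniteDimensional ℂ U), ‖k - U.starProjection ∘L k‖ ≤ ε := by
  have hk' : IsCompactOperator (k : E →ₗ[ℂ] F) := hk
  obtain ⟨K, hK, hkK⟩ := hk'.image_closedBall_subset_compact 1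
  obtain ⟨t, -, ht, htK⟩ := hK.finite_cover_balls hε
  have hfin : FiniteDimensional ℂ (Submodule.span ℂ t) := .span_of_finite ℂ ht
  refine ⟨Submodule.span ℂ t, hfin, ?_⟩
  refine ContinuousLinearMap.opNorm_le_of_unit_norm (𝕜 := ℂ) hε.le fun x hx => ?_
  have hx' : k x ∈ K := hkK ⟨x, by simp [hx], rfl⟩
  obtain ⟨y, hy, hxy⟩ := Set.mem_iUnion₂.mp (htK hx')
  have hmin := Submodule.starProjection_minimal (U := Submodule.span ℂ t) (k x)
  calc ‖(k - (Submodule.span ℂ t).starProjection ∘L k) x‖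
      = ⨅ w : Submodule.span ℂ t, ‖k x - w‖ := by simpa using hmin
    _ ≤ ‖k x - y‖ := ciInf_le ⟨0, by rintro _ ⟨w, rfl⟩; positivity⟩
        (⟨y, Submodule.subset_span hy⟩ : Submodule.span ℂ t)
    _ ≤ ε := (mem_ball_iff_norm.mp hxy).le

/-- The adjoint of a compact operator on a Hilbert space is compact. -/
theorem IsCompactOperator.star {E : Type*} [NormedAddCommGroup E] [InnerProductSpace ℂ E]
    [CompleteSpace E] {k : E →L[ℂ] E} (hk : IsCompactOperator k) :
    IsCompactOperator (star k : E →L[ℂ] E) := by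
  have hcl : IsClosed {f : E →L[ℂ] E | IsCompactOperator f} :=
    isClosed_setOfPred_isCompactOperator
  refine hcl.closure_subset (Metric.mem_closure_iff.mpr fun ε hε => ?_)
  obtain ⟨U, hU, hle⟩ := hk.exists_norm_sub_starProjection_comp_le (half_pos hε)
  refine ⟨Star.star (U.starProjection * k), ?_, ?_⟩
  · have hP : Star.star U.starProjection = U.starProjection :=
      isSelfAdjoint_starProjection U
    rw [star_mul, hP]
    exact U.isCompactOperator_starProjection.clm_comp (Star.star k)
  · rw [dist_eq_norm, ← star_sub, norm_star]
    exact hle.trans_lt (half_lt_self hε)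

/-- The compact operators on a Hilbert space, as a non-unital star subalgebra of the bounded
operators. -/
def compactStarSubalgebra (E : Type*) [NormedAddCommGroup E] [InnerProductSpace ℂ E]
    [CompleteSpace E] : NonUnitalStarSubalgebra ℂ (E →L[ℂ] E) where
  carrier := {k | IsCompactOperator k}
  add_mem' := fun hk hl => hk.add hl
  zero_mem' := isCompactOperator_zero
  mul_mem' := fun {_ l} hk _ => hk.comp_clm l
  smul_mem' := fun c _ hk => hk.smul c
  star_mem' := fun hk => hk.star

namespace compactStarSubalgebra

open InnerProductSpace

variable {E : Type*} [NormedAddCommGroup E] [InnerProductSpace ℂ E] [CompleteSpace E]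
  {F : Type*} [NormedAddCommGroup F] [InnerProductSpace ℂ F] [CompleteSpace F]

instance : IsClosed (compactStarSubalgebra E : Set (E →L[ℂ] E)) :=
  isClosed_setOfPred_isCompactOperator

/-- The rank-one operator `z ↦ ⟪y, z⟫ x` as a compact operator. -/
noncomputable def single (x y : E) : compactStarSubalgebra E :=
  ⟨rankOne ℂ x y, isCompactOperator_rankOne x y⟩

theorem mul_single (k : compactStarSubalgebra E) (x y : E) :
    k * single x y = single ((k : E →L[ℂ] E) x) y :=
  Subtype.ext (comp_rankOne x y k.1)

theorem single_mul_single (x y z w : E) :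
    single x y * single z w = inner ℂ y z • single x w := by
  refine Subtype.ext (ContinuousLinearMap.ext fun v => ?_)
  simp [single, smul_smul, mul_comm]

theorem star_single (x y : E) : star (single x y) = single y x :=
  Subtype.ext (adjoint_rankOne x y)

theorem single_add (x x' y : E) : single (x + x') y = single x y + single x' y :=
  Subtype.ext (by simp [single])

theorem single_smul (c : ℂ) (x y : E) : single (c • x) y = c • single x y :=
  Subtype.ext (by simp [single])

/-- A star homomorphism of the compact operators that vanishes on one rank-one projection
vanishes. -/
theorem map_eq_zero_of_map_single_self_eq_zero
    (φ : compactStarSubalgebra E →⋆ₙₐ[ℂ] (F →L[ℂ] F)) {e : E} (he : ‖e‖ = 1)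
    (h : φ (single e e) = 0) (k : compactStarSubalgebra E) : φ k = 0 := by
  have hee : inner ℂ e e = 1 := by simp [inner_self_eq_norm_sq_to_K, he]
  have h_single : ∀ x y, φ (single x y) = 0 := fun x y => by
    have : single x y = single x e * single e e * single e y := by
      rw [single_mul_single, hee, one_smul, single_mul_single, hee, one_smul]
    rw [this, map_mul, map_mul, h, mul_zero, zero_mul]
  rw [← norm_le_zero_iff]
  refine le_of_forall_pos_le_add fun ε hε => ?_
  obtain ⟨U, hU, hle⟩ := k.2.exists_norm_sub_starProjection_comp_le hε
  let P : compactStarSubalgebra E := ⟨U.starProjection, U.isCompactOperator_starProjection⟩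
  have hP : P = ∑ i, single (stdOrthonormalBasis ℂ U i : E) (stdOrthonormalBasis ℂ U i : E) :=
    Subtype.ext <| by
      simpa [P, single] using (stdOrthonormalBasis ℂ U).starProjection_eq_sum_rankOne
  have hφP : φ P = 0 := by simp [hP, map_sum, h_single]
  calc ‖φ k‖ = ‖φ (k - P * k)‖ := by simp [map_sub, map_mul, hφP]
    _ ≤ ‖k - P * k‖ := NonUnitalStarAlgHom.norm_apply_le φ _
    _ ≤ 0 + ε := by rw [zero_add]; exact hle

/-- A nonzero star homomorphism of the compact operators on `E` into the bounded operators on `F`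
contains the identity representation: it is intertwined by an isometry `E → F`. -/
theorem exists_linearIsometry_intertwining [Nontrivial E]
    (φ : compactStarSubalgebra E →⋆ₙₐ[ℂ] (F →L[ℂ] F)) (hφ : ∃ k, φ k ≠ 0) :
    ∃ u : E →ₗᵢ[ℂ] F, ∀ (k : compactStarSubalgebra E) (x : E),
      φ k (u x) = u ((k : E →L[ℂ] E) x) := by
  obtain ⟨e, he⟩ := exists_norm_eq E zero_le_one
  have hee : inner ℂ e e = 1 := by simp [inner_self_eq_norm_sq_to_K, he]
  have hp : φ (single e e) ≠ 0 := fun h =>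
    hφ.elim fun k hk => hk (map_eq_zero_of_map_single_self_eq_zero φ he h k)
  obtain ⟨η, hη⟩ : ∃ η, φ (single e e) η ≠ 0 := by
    by_contra! h
    exact hp (ContinuousLinearMap.ext h)
  obtain ⟨ξ, hξ, hpξ⟩ : ∃ ξ, ‖ξ‖ = 1 ∧ φ (single e e) ξ = ξ := by
    refine ⟨((‖φ (single e e) η‖⁻¹ : ℝ) : ℂ) • φ (single e e) η, ?_, ?_⟩
    · rw [norm_smul, Complex.norm_real, norm_inv, norm_norm,
        inv_mul_cancel₀ (norm_ne_zero_iff.mpr hη)]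
    · rw [map_smul, ← mul_apply_eq_comp, ← map_mul, single_mul_single, hee, one_smul]
  let u₀ : E →ₗ[ℂ] F :=
    { toFun := fun x => φ (single x e) ξ
      map_add' := fun x y => by simp [single_add, map_add]
      map_smul' := fun c x => by simp [single_smul, map_smul] }
  refine ⟨u₀.isometryOfInner fun x y => ?_, fun k x => ?_⟩
  · calc inner ℂ (φ (single x e) ξ) (φ (single y e) ξ)
        = inner ℂ ξ (φ (star (single x e) * single y e) ξ) := by
          rw [map_mul, map_star, mul_apply_eq_comp,
            ContinuousLinearMap.star_eq_adjoint, ContinuousLinearMap.adjoint_inner_right]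
      _ = inner ℂ x y := by
          rw [star_single, single_mul_single, map_smul, smul_apply, hpξ,
            inner_smul_right, inner_self_eq_norm_sq_to_K, hξ]
          simp
  · change φ k (φ (single x e) ξ) = φ (single ((k : E →L[ℂ] E) x) e) ξ
    rw [← mul_single, map_mul, mul_apply_eq_comp]

end compactStarSubalgebra

/-- Every nonzero irreducible representation of the C*-algebra `K(H)` of compact operators on a
nonzero complex Hilbert space `H` is unitarily equivalent to the identity representation:
there is a unitary `u : H → H'` with `π(k) = u ∘ k ∘ u⁻¹` for all compact `k`. -/
theorem irreducible_rep_of_compacts_is_identity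
    {H : Type} [NormedAddCommGroup H] [InnerProductSpace ℂ H] [CompleteSpace H] [Nontrivial H]
    {H' : Type} [NormedAddCommGroup H'] [InnerProductSpace ℂ H'] [CompleteSpace H'] [Nontrivial H']
    (π : (H →L[ℂ] H) → (H' →L[ℂ] H'))
    (h_add : ∀ k l : H →L[ℂ] H, IsCompactOperator k → IsCompactOperator l →
      π (k + l) = π k + π l)
    (h_smul : ∀ (c : ℂ) (k : H →L[ℂ] H), IsCompactOperator k → π (c • k) = c • π k)
    (h_mul : ∀ k l : H →L[ℂ] H, IsCompactOperator k → IsCompactOperator l →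
      π (k * l) = π k * π l)
    (h_star : ∀ k : H →L[ℂ] H, IsCompactOperator k → π (star k) = star (π k))
    (h_nonzero : ∃ k : H →L[ℂ] H, IsCompactOperator k ∧ π k ≠ 0)
    (h_irr : ∀ V : Submodule ℂ H', IsClosed (V : Set H') →
        (∀ k : H →L[ℂ] H, IsCompactOperator k → ∀ v ∈ V, π k v ∈ V) → V = ⊥ ∨ V = ⊤) :
    ∃ u : H ≃ₗᵢ[ℂ] H', ∀ k : H →L[ℂ] H, IsCompactOperator k →
      ∀ ξ : H', π k ξ = u (k (u.symm ξ)) := by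
  let φ : compactStarSubalgebra H →⋆ₙₐ[ℂ] (H' →L[ℂ] H') :=
    { toFun := fun k => π k
      map_smul' := fun c k => h_smul c k k.2
      map_zero' := by simpa using h_smul 0 0 isCompactOperator_zero
      map_add' := fun k l => h_add k l k.2 l.2
      map_mul' := fun k l => h_mul k l k.2 l.2
      map_star' := fun k => h_star k k.2 }
  obtain ⟨k₀, hk₀, hπk₀⟩ := h_nonzero
  obtain ⟨u, hu⟩ :=
    compactStarSubalgebra.exists_linearIsometry_intertwining φ ⟨⟨k₀, hk₀⟩, hπk₀⟩
  have hπ : ∀ k : H →L[ℂ] H, IsCompactOperator k → ∀ x, π k (u x) = u (k x) :=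
    fun k hk => hu ⟨k, hk⟩
  have h_range : LinearMap.range u.toLinearMap = ⊤ := by
    refine (h_irr _ u.isometry.isClosedEmbedding.isClosed_range ?_).resolve_left fun h => ?_
    · rintro k hk _ ⟨x, rfl⟩
      exact ⟨k x, (hπ k hk x).symm⟩
    · obtain ⟨x, hx⟩ := exists_ne (0 : H)
      have hux : u x = 0 := LinearMap.congr_fun (LinearMap.range_eq_bot.mp h) x
      exact hx (u.injective (hux.trans (map_zero u).symm))
  let v := LinearIsometryEquiv.ofSurjective u (LinearMap.range_eq_top.mp h_range)
  refine ⟨v, fun k hk ξ => ?_⟩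
  conv_lhs => rw [← v.apply_symm_apply ξ]
  exact hπ k hk (v.symm ξ)
end

section
/- Let H be a nonzero complex Hilbert space and let B be a norm-closed ℂ-subalgebra of B(H), closed under adjoints, with B ≠ {0}, such that every element of B is a compact operator and such that the only closed subspaces of H invariant under every element of B are 0 and H. Then B = K(H), the set of all compact operators on H. (This is the Stone–Weierstrass property for K(H).) -/
open InnerProductSpace

section
variable {H : Type*} [NormedAddCommGroup H] [InnerProductSpace ℂ H]

/-- A closed subspace fixed pointwise by a compact operator is finite-dimensional. -/
theorem IsCompactOperator.finiteDimensional_of_fixed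
    {G : H →L[ℂ] H} (hG : IsCompactOperator G) {W : Submodule ℂ H} (hW : IsClosed (W : Set H))
    (hfix : ∀ w ∈ W, G w = w) : FiniteDimensional ℂ W := by
  have hmaps : ∀ w ∈ W, (G : H →ₗ[ℂ] H) w ∈ W := fun w hw ↦ by
    simpa [hfix w hw] using hw
  have h := IsCompactOperator.restrict (f := (G : H →ₗ[ℂ] H)) hG hmaps hW
  have hid : ((G : H →ₗ[ℂ] H).restrict hmaps : W → W) = id :=
    funext fun w ↦ Subtype.ext (hfix w w.2)
  rw [hid] at h
  exact FiniteDimensional.of_isCompactOperator_id (𝕜 := ℂ) h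

variable [CompleteSpace H]

/-- A nonzero closed star-subalgebra of compact operators contains a nonzero operator of finite
rank. -/
theorem NonUnitalStarSubalgebra.exists_finiteDimensional_range
    (B : NonUnitalStarSubalgebra ℂ (H →L[ℂ] H)) (hB : IsClosed (B : Set (H →L[ℂ] H)))
    (hcompact : ∀ s ∈ B, IsCompactOperator s) {s : H →L[ℂ] H} (hs : s ∈ B) (hs0 : s ≠ 0) :
    ∃ F ∈ B, F ≠ 0 ∧ FiniteDimensional ℂ (F : H →ₗ[ℂ] H).range := by
  set a : H →L[ℂ] H := star s * s with ha
  have haB : a ∈ B := mul_mem (star_mem hs) hs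
  have ha0 : 0 ≤ a := star_mul_self_nonneg s
  have hpos : 0 < ‖a‖ := by
    rw [ha, CStarRing.norm_star_mul_self]
    have := norm_pos_iff.mpr hs0
    positivity
  have hsa : IsSelfAdjoint a := ha0.isSelfAdjoint
  set c : ℝ := ‖a‖ / 2 with hc
  have hc0 : 0 < c := by positivity
  have hcfc (f : ℝ → ℝ) : cfcₙ f a ∈ B :=
    cfcₙ_mem (hs := hB) f haB
  set f : ℝ → ℝ := fun t ↦ max 0 (t - c) with hf
  set k : ℝ → ℝ := fun t ↦ min t c with hk
  set g : ℝ → ℝ := fun t ↦ min (t / c) 1 with hg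
  have hf_cont : Continuous f := by fun_prop
  have hk_cont : Continuous k := by fun_prop
  have hg_cont : Continuous g := by fun_prop
  have hf0 : f 0 = 0 := by simp [hf, hc0.le]
  have hk0 : k 0 = 0 := by simp [hk, hc0.le]
  have hg0 : g 0 = 0 := by simp [hg]
  have hgf : cfcₙ g a * cfcₙ f a = cfcₙ f a := by
    rw [← cfcₙ_mul g f a hg_cont.continuousOn hg0 hf_cont.continuousOn hf0]
    congr 1
    ext t
    rcases le_total t c with h | h
    · simp [hf, h]
    · have : 1 ≤ t / c := by rwa [one_le_div hc0]
      simp [hg, this]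
  refine ⟨cfcₙ f a, hcfc f, fun hzero ↦ ?_, ?_⟩
  · have hsum : cfcₙ f a + cfcₙ k a = a := by
      rw [← cfcₙ_add f k a hf_cont.continuousOn hf0 hk_cont.continuousOn hk0]
      conv_rhs => rw [← cfcₙ_id' ℝ a hsa]
      congr 1
      ext t
      rcases le_total t c with h | h <;> simp [hf, hk, h]
    rw [hzero, zero_add] at hsum
    have hle : ‖cfcₙ k a‖ ≤ c := by
      refine norm_cfcₙ_le fun x hx ↦ ?_
      have hx0 : 0 ≤ x := quasispectrum_nonneg_of_nonneg a ha0 x hx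
      rw [Real.norm_of_nonneg (le_min hx0 hc0.le)]
      exact min_le_right _ _
    rw [hsum] at hle
    linarith
  · set G := cfcₙ g a
    have := (hcompact G (hcfc g)).finiteDimensional_of_fixed
      (W := (G - 1 : H →L[ℂ] H).ker) (G - 1).isClosed_ker
      (fun w hw ↦ by simpa [sub_eq_zero] using hw)
    refine Submodule.finiteDimensional_of_le (S₂ := (G - 1 : H →L[ℂ] H).ker) ?_
    rintro _ ⟨x, rfl⟩
    have := congrArg (· x) hgf
    simpa [sub_eq_zero] using this

/-- An operator whose range lies in the line spanned by `u` is of the form `rankOne u v`. -/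
theorem ContinuousLinearMap.exists_eq_rankOne_of_range_le_span
    {F : H →L[ℂ] H} {u : H} (hu : u ≠ 0) (h : ∀ x, F x ∈ Submodule.span ℂ {u}) :
    ∃ v, F = rankOne ℂ u v := by
  refine ⟨((‖u‖ : ℂ) ^ 2)⁻¹ • ContinuousLinearMap.adjoint F u, ?_⟩
  ext x
  obtain ⟨c, hc⟩ := Submodule.mem_span_singleton.mp (h x)
  have : (‖u‖ : ℂ) ≠ 0 := by simpa using hu
  simp only [rankOne_apply, inner_smul_left, ContinuousLinearMap.adjoint_inner_left, ← hc,
    inner_smul_right, inner_self_eq_norm_sq_to_K]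
  congr 1
  simp
  field_simp

/-- A closed additive submonoid containing all operators `rankOne x y` contains every compact
operator. -/
theorem IsCompactOperator.mem_of_rankOne_mem (B : AddSubmonoid (H →L[ℂ] H))
    (hB : IsClosed (B : Set (H →L[ℂ] H))) (hrank : ∀ x y : H, rankOne ℂ x y ∈ B)
    {T : H →L[ℂ] H} (hT : IsCompactOperator T) : T ∈ B := by
  rw [← SetLike.mem_coe, ← hB.closure_eq, Metric.mem_closure_iff]
  intro ε hε
  obtain ⟨K, hK, hTK⟩ := IsCompactOperator.image_closedBall_subset_compact
    (f := (T : H →ₗ[ℂ] H)) hT 1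
  obtain ⟨t, -, ht, hcover⟩ := hK.finite_cover_balls (half_pos hε)
  let V := Submodule.span ℂ t
  have : FiniteDimensional ℂ V := FiniteDimensional.span_of_finite ℂ ht
  let b := stdOrthonormalBasis ℂ V
  refine ⟨V.starProjection * T, ?_, ?_⟩
  · have : V.starProjection * T =
        ∑ i, rankOne ℂ (b i : H) (ContinuousLinearMap.adjoint T (b i)) := by
      rw [b.starProjection_eq_sum_rankOne, Finset.sum_mul]
      exact Finset.sum_congr rfl fun i _ ↦ rankOne_comp _ _ _
    rw [this]
    exact sum_mem fun i _ ↦ hrank _ _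
  · rw [dist_eq_norm]
    refine (ContinuousLinearMap.opNorm_le_of_unit_norm (𝕜 := ℂ) (half_pos hε).le
      fun x hx ↦ ?_).trans_lt (half_lt_self hε)
    have hTx := hcover (hTK ⟨x, by simp [hx], rfl⟩)
    simp only [Set.mem_iUnion] at hTx
    obtain ⟨y, hy, hxy⟩ := hTx
    rw [Metric.mem_ball, dist_eq_norm] at hxy
    have hmin : ‖T x - V.starProjection (T x)‖ ≤ ‖T x - y‖ := by
      rw [V.starProjection_minimal (T x)]
      exact ciInf_le ⟨0, Set.forall_mem_range.mpr fun _ ↦ norm_nonneg _⟩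
        (⟨y, Submodule.subset_span hy⟩ : V)
    exact hmin.trans hxy.le

/-- A nonzero finite-rank operator of minimal rank in a topologically transitive algebra has
rank one. -/
theorem NonUnitalStarSubalgebra.exists_rankOne_mem
    (B : NonUnitalStarSubalgebra ℂ (H →L[ℂ] H))
    (hdense : ∀ x : H, x ≠ 0 → Dense {y | ∃ s ∈ B, s x = y})
    (hfin : ∃ F ∈ B, F ≠ 0 ∧ FiniteDimensional ℂ (F : H →ₗ[ℂ] H).range) :
    ∃ u v : H, u ≠ 0 ∧ v ≠ 0 ∧ rankOne ℂ u v ∈ B := by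
  obtain ⟨F, ⟨hFB, hF0, hFfin⟩, hmin⟩ := exists_minimalFor_of_wellFoundedLT
    (fun F : H →L[ℂ] H ↦ F ∈ B ∧ F ≠ 0 ∧ FiniteDimensional ℂ (F : H →ₗ[ℂ] H).range)
    (fun F ↦ Module.finrank ℂ (F : H →ₗ[ℂ] H).range) hfin
  obtain ⟨x₀, hx₀⟩ : ∃ x, F x ≠ 0 := by
    by_contra! h
    exact hF0 (ContinuousLinearMap.ext h)
  have hscalar (T : H →L[ℂ] H) (hT : T ∈ B) : ∃ c : ℂ, F * T * F = c • F := by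
    set V := (F : H →ₗ[ℂ] H).range
    have : Nontrivial V := ⟨⟨F x₀, x₀, rfl⟩, 0, fun h ↦ hx₀ (congrArg Subtype.val h)⟩
    have hmaps : ∀ v ∈ V, ((F * T : H →L[ℂ] H) : H →ₗ[ℂ] H) v ∈ V := fun v _ ↦ ⟨T v, rfl⟩
    obtain ⟨c, hc⟩ := Module.End.exists_eigenvalue
      (((F * T : H →L[ℂ] H) : H →ₗ[ℂ] H).restrict hmaps)
    obtain ⟨⟨w, z, hz⟩, hw, hw0⟩ := hc.exists_hasEigenvector
    rw [Module.End.mem_eigenspace_iff] at hw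
    refine ⟨c, ?_⟩
    set D := F * T * F - c • F with hD
    rw [← sub_eq_zero]
    by_contra hne'
    have hDB : D ∈ B := sub_mem (mul_mem (mul_mem hFB hT) hFB) (SMulMemClass.smul_mem c hFB)
    have hDV : (D : H →ₗ[ℂ] H).range ≤ V := by
      rintro _ ⟨x, rfl⟩
      exact sub_mem ⟨T (F x), rfl⟩ (V.smul_mem c ⟨x, rfl⟩)
    have hDfin : FiniteDimensional ℂ (D : H →ₗ[ℂ] H).range :=
      Submodule.finiteDimensional_of_le hDV
    have hrange : (D : H →ₗ[ℂ] H).range = V := by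
      refine Submodule.eq_of_le_of_finrank_le hDV ?_
      exact hmin ⟨hDB, hne', hDfin⟩ (Submodule.finrank_mono hDV)
    let E : V →ₗ[ℂ] V := ((F * T : H →L[ℂ] H) : H →ₗ[ℂ] H).restrict hmaps - c • 1
    have hsurj : Function.Surjective E := by
      rintro ⟨y, hy⟩
      obtain ⟨x, rfl⟩ := hrange.ge hy
      exact ⟨⟨F x, x, rfl⟩, rfl⟩
    refine hw0 (LinearMap.injective_iff_surjective.mpr hsurj ?_)
    rw [map_zero]
    exact sub_eq_zero.mpr hw
  have hclosed : IsClosed (F ⁻¹' (Submodule.span ℂ {F x₀} : Set H)) :=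
    (Submodule.closed_of_finiteDimensional _).preimage F.continuous
  have hspan (x : H) : F x ∈ Submodule.span ℂ {F x₀} := by
    refine hclosed.closure_subset_iff.mpr ?_ (hdense _ hx₀ x)
    rintro _ ⟨T, hT, rfl⟩
    obtain ⟨c, hc⟩ := hscalar T hT
    exact Submodule.mem_span_singleton.mpr ⟨c, (congrArg (· x₀) hc).symm⟩
  obtain ⟨v, hv⟩ := ContinuousLinearMap.exists_eq_rankOne_of_range_le_span hx₀ hspan
  refine ⟨F x₀, v, hx₀, ?_, hv ▸ hFB⟩
  rintro rfl
  exact hF0 (by simpa using hv)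

/-- A closed topologically transitive star-subalgebra containing one nonzero rank-one operator
contains them all. -/
theorem NonUnitalStarSubalgebra.rankOne_mem
    (B : NonUnitalStarSubalgebra ℂ (H →L[ℂ] H)) (hB : IsClosed (B : Set (H →L[ℂ] H)))
    (hdense : ∀ x : H, x ≠ 0 → Dense {y | ∃ s ∈ B, s x = y})
    {u v : H} (hu : u ≠ 0) (hv : v ≠ 0) (huv : rankOne ℂ u v ∈ B) (x y : H) :
    rankOne ℂ x y ∈ B := by
  have hleft (x : H) : rankOne ℂ x v ∈ B := by
    have hclosed : IsClosed ((fun x : H ↦ rankOne ℂ x v) ⁻¹' (B : Set (H →L[ℂ] H))) :=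
      hB.preimage (by fun_prop)
    refine hclosed.closure_subset_iff.mpr ?_ (hdense u hu x)
    rintro _ ⟨s, hs, rfl⟩
    rw [Set.mem_preimage, ← comp_rankOne]
    exact mul_mem hs huv
  have hclosed : IsClosed ((fun y : H ↦ rankOne ℂ x y) ⁻¹' (B : Set (H →L[ℂ] H))) :=
    hB.preimage (by fun_prop)
  refine hclosed.closure_subset_iff.mpr ?_ (hdense v hv y)
  rintro _ ⟨s, hs, rfl⟩
  have h := mul_mem (hleft x) (star_mem hs)
  rwa [ContinuousLinearMap.star_eq_adjoint, ContinuousLinearMap.mul_def, rankOne_comp,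
    ContinuousLinearMap.adjoint_adjoint] at h

/-- Every nonzero vector has a dense orbit under a nonzero irreducible operator algebra. -/
theorem NonUnitalStarSubalgebra.dense_orbit
    (B : NonUnitalStarSubalgebra ℂ (H →L[ℂ] H)) (hne : ∃ s ∈ B, s ≠ 0)
    (hirr : ∀ V : Submodule ℂ H, IsClosed (V : Set H) →
        (∀ s ∈ B, ∀ v ∈ V, s v ∈ V) → V = ⊥ ∨ V = ⊤) {x : H} (hx : x ≠ 0) :
    Dense {y | ∃ s ∈ B, s x = y} := by
  let W : Submodule ℂ H :=
    B.toNonUnitalSubalgebra.toSubmodule.map (ContinuousLinearMap.apply ℂ H x).toLinearMap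
  have hWmem (y : H) : y ∈ W ↔ ∃ s ∈ B, s x = y := Iff.rfl
  have hW : ({y | ∃ s ∈ B, s x = y} : Set H) = W := rfl
  rw [hW, Submodule.dense_iff_topologicalClosure_eq_top]
  refine (hirr _ W.isClosed_topologicalClosure fun s hs v hv ↦ ?_).resolve_left fun hbot ↦ ?_
  · refine map_mem_closure s.continuous hv ?_
    rintro _ ⟨t, ht, rfl⟩
    exact ⟨s * t, B.mul_mem hs ht, rfl⟩
  · let N : Submodule ℂ H := ⨅ s : B, (s : H →L[ℂ] H).ker
    have hNmem (y : H) : y ∈ N ↔ ∀ s ∈ B, s y = 0 := by simp [N]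
    have hNclosed : IsClosed (N : Set H) := by
      simp only [N, Submodule.coe_iInf]
      exact isClosed_iInter fun s ↦ (s : H →L[ℂ] H).isClosed_ker
    rcases hirr N hNclosed fun s hs v hv ↦ (by
        rw [(hNmem v).mp hv s hs]; exact N.zero_mem) with h | h
    · refine hx ((Submodule.mem_bot ℂ).mp (h ▸ (hNmem x).mpr fun s hs ↦ ?_))
      have : s x ∈ W.topologicalClosure := W.le_topologicalClosure ((hWmem _).mpr ⟨s, hs, rfl⟩)
      rwa [hbot, Submodule.mem_bot] at this
    · obtain ⟨s, hs, hs0⟩ := hne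
      exact hs0 (ContinuousLinearMap.ext fun y ↦ (hNmem y).mp (h ▸ Submodule.mem_top) s hs)

end


/-- **Stone–Weierstrass property for `K(H)`.** A nonzero norm-closed star-closed ℂ-subalgebra
of `B(H)` consisting of compact operators and acting irreducibly on the nonzero complex Hilbert
space `H` is all of `K(H)`. -/
theorem stone_weierstrass_property_for_compacts
    {H : Type} [NormedAddCommGroup H] [InnerProductSpace ℂ H] [CompleteSpace H] [Nontrivial H]
    (B : Set (H →L[ℂ] H))
    (hB_closed : IsClosed B)
    (h_zero : (0 : H →L[ℂ] H) ∈ B)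
    (h_add : ∀ s ∈ B, ∀ t ∈ B, s + t ∈ B)
    (h_smul : ∀ (c : ℂ), ∀ s ∈ B, c • s ∈ B)
    (h_mul : ∀ s ∈ B, ∀ t ∈ B, s * t ∈ B)
    (h_star : ∀ s ∈ B, star s ∈ B)
    (h_compact : ∀ s ∈ B, IsCompactOperator s)
    (h_ne : B ≠ {0})
    (h_irr : ∀ V : Submodule ℂ H, IsClosed (V : Set H) →
        (∀ s ∈ B, ∀ v ∈ V, s v ∈ V) → V = ⊥ ∨ V = ⊤) :
    B = {T : H →L[ℂ] H | IsCompactOperator T} := by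
  let A : NonUnitalStarSubalgebra ℂ (H →L[ℂ] H) :=
    { carrier := B
      zero_mem' := h_zero
      add_mem' := fun {s t} hs ht ↦ h_add s hs t ht
      mul_mem' := fun {s t} hs ht ↦ h_mul s hs t ht
      smul_mem' := fun c s hs ↦ h_smul c s hs
      star_mem' := fun {s} hs ↦ h_star s hs }
  have hA_ne : ∃ s ∈ A, s ≠ 0 := by
    by_contra! h
    exact h_ne (Set.eq_singleton_iff_unique_mem.mpr ⟨h_zero, h⟩)
  have hdense (x : H) (hx : x ≠ 0) : Dense {y | ∃ s ∈ A, s x = y} :=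
    A.dense_orbit hA_ne h_irr hx
  obtain ⟨s, hs, hs0⟩ := hA_ne
  obtain ⟨u, v, hu, hv, huv⟩ := A.exists_rankOne_mem hdense
    (A.exists_finiteDimensional_range hB_closed h_compact hs hs0)
  refine Set.Subset.antisymm h_compact fun T hT ↦ ?_
  exact IsCompactOperator.mem_of_rankOne_mem A.toAddSubmonoid hB_closed
    (A.rankOne_mem hB_closed hdense hu hv huv) hT
end

section
/- Let A be a C*-algebra, let I and J be norm-closed two-sided ideals of A, let c ∈ I + J, and let ε > 0. Then there exist c_I ∈ I and c_J ∈ J with c = c_I + c_J, ‖c_I‖ ≤ (1+ε)·‖c‖, and ‖c_J‖ ≤ (2+ε)·‖c‖. -/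
open Unitization in
/-- For every `j` in a non-unital C*-algebra and every `δ > 0` there is a right multiple `e` of
`star j * j` which is a contractive approximate right unit at `j`: multiplication by `1 - e` is
contractive and moves `j` to within `δ` of zero. -/
theorem exists_mul_approx_right_unit {A : Type*} [NonUnitalCStarAlgebra A] (j : A) {δ : ℝ}
    (hδ : 0 < δ) :
    ∃ b : A, (∀ x : A, ‖x - x * (star j * j * b)‖ ≤ ‖x‖) ∧ ‖j - j * (star j * j * b)‖ ≤ δ := by
  set s : ℝ := δ ^ 2 with hs
  have hs0 : 0 < s := by positivity
  have hpos : ∀ t : ℝ, 0 < t ^ 2 + s ^ 2 := fun t => by positivity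
  have hne : ∀ t : ℝ, t ^ 2 + s ^ 2 ≠ 0 := fun t => (hpos t).ne'
  let g : ℝ → ℝ := fun t => t / (t ^ 2 + s ^ 2)
  let f : ℝ → ℝ := fun t => s ^ 2 / (t ^ 2 + s ^ 2)
  have hg : Continuous g := by fun_prop (disch := exact hne _)
  have hf : Continuous f := by fun_prop (disch := exact hne _)
  have hsa : IsSelfAdjoint (star j * j) := .star_mul_self j
  have hsa' : IsSelfAdjoint ((star j * j : A) : Unitization ℂ A) := hsa.inr ℂ
  have hb : ((cfcₙ g (star j * j) : A) : Unitization ℂ A)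
      = cfc g ((star j * j : A) : Unitization ℂ A) :=
    real_cfcₙ_eq_cfc_inr _ _ (by simp [g])
  have h1e : 1 - ((star j * j * cfcₙ g (star j * j) : A) : Unitization ℂ A)
      = cfc f ((star j * j : A) : Unitization ℂ A) := by
    rw [inr_mul, hb]
    nth_rewrite 1 [← cfc_id' ℝ ((star j * j : A) : Unitization ℂ A)]
    rw [← cfc_mul .., ← cfc_one ℝ ((star j * j : A) : Unitization ℂ A), ← cfc_sub ..]
    refine cfc_congr fun t _ => ?_
    have := hne t
    simp only [Pi.one_apply, f, g]
    field_simp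
    ring
  have hmul (x : A) : ((x - x * (star j * j * cfcₙ g (star j * j)) : A) : Unitization ℂ A)
      = x * cfc f ((star j * j : A) : Unitization ℂ A) := by
    rw [← h1e, mul_sub, mul_one, ← inr_mul, ← inr_sub]
  refine ⟨cfcₙ g (star j * j), fun x => ?_, ?_⟩
  · rw [← norm_inr (𝕜 := ℂ), hmul, ← norm_inr (𝕜 := ℂ) x]
    refine (norm_mul_le _ _).trans (mul_le_of_le_one_right (norm_nonneg _) ?_)
    refine norm_cfc_le zero_le_one fun t _ => ?_
    rw [Real.norm_of_nonneg (by positivity), div_le_one (hpos t)]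
    nlinarith [sq_nonneg t]
  · have hstar : star ((j : Unitization ℂ A) * cfc f ((star j * j : A) : Unitization ℂ A))
        * (j * cfc f ((star j * j : A) : Unitization ℂ A))
        = cfc (fun t => f t * (t * f t)) ((star j * j : A) : Unitization ℂ A) := by
      rw [cfc_mul f (fun t => t * f t) _, cfc_mul (fun t => t) f _, cfc_id' ℝ _, star_mul,
        (cfc_predicate f ((star j * j : A) : Unitization ℂ A)).star_eq, inr_mul, inr_star]
      simp only [mul_assoc]
    rw [← norm_inr (𝕜 := ℂ), hmul]
    refine le_of_sq_le_sq ?_ hδ.le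
    rw [sq, ← CStarRing.norm_star_mul_self, hstar, ← hs]
    refine norm_cfc_le hs0.le fun t _ => ?_
    have h : f t * (t * f t) = t * s ^ 4 / (t ^ 2 + s ^ 2) ^ 2 := by
      have := hne t
      simp only [f]
      field_simp
    have hts : |t| * s ≤ t ^ 2 + s ^ 2 := by nlinarith [sq_nonneg (|t| - s), sq_abs t]
    have hss : s ^ 2 ≤ t ^ 2 + s ^ 2 := by nlinarith [sq_nonneg t]
    rw [h, norm_div, norm_mul, Real.norm_eq_abs, Real.norm_of_nonneg (by positivity),
      Real.norm_of_nonneg (by positivity), div_le_iff₀ (by have := hpos t; positivity)]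
    calc |t| * s ^ 4 = s * ((|t| * s) * s ^ 2) := by ring
      _ ≤ s * ((t ^ 2 + s ^ 2) * (t ^ 2 + s ^ 2)) := by gcongr
      _ = s * (t ^ 2 + s ^ 2) ^ 2 := by ring

/-- If `I` and `J` are norm-closed two-sided ideals in a C*-algebra, `c ∈ I + J`, and `ε > 0`,
then `c = c_I + c_J` with `c_I ∈ I`, `c_J ∈ J`, `‖c_I‖ ≤ (1+ε)‖c‖` and `‖c_J‖ ≤ (2+ε)‖c‖`. -/
theorem ideal_sum_decomposition_with_norm_bounds
    {A : Type} [NonUnitalCStarAlgebra A]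
    (I J : TwoSidedIdeal A)
    (hI : IsClosed (I : Set A)) (hJ : IsClosed (J : Set A))
    (c : A) (hc : ∃ i ∈ I, ∃ j ∈ J, c = i + j)
    (ε : ℝ) (hε : 0 < ε) :
    ∃ cI ∈ I, ∃ cJ ∈ J, c = cI + cJ ∧
      ‖cI‖ ≤ (1 + ε) * ‖c‖ ∧ ‖cJ‖ ≤ (2 + ε) * ‖c‖ := by
  obtain rfl | hc0 := eq_or_ne c 0
  · exact ⟨0, I.zero_mem, 0, J.zero_mem, by simp⟩
  obtain ⟨i, hi, j, hj, rfl⟩ := hc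
  obtain ⟨b, hb, hbj⟩ :=
    exists_mul_approx_right_unit j (mul_pos hε (norm_pos_iff.mpr hc0))
  set e := star j * j * b
  have he : e ∈ J := J.mul_mem_right _ _ (J.mul_mem_left _ _ hj)
  have hcI : ‖i - i * e‖ ≤ (1 + ε) * ‖i + j‖ := by
    calc ‖i - i * e‖ = ‖((i + j) - (i + j) * e) - (j - j * e)‖ := by congr 1; noncomm_ring
      _ ≤ ‖(i + j) - (i + j) * e‖ + ‖j - j * e‖ := norm_sub_le _ _
      _ ≤ ‖i + j‖ + ε * ‖i + j‖ := add_le_add (hb _) hbj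
      _ = (1 + ε) * ‖i + j‖ := by ring
  refine ⟨i - i * e, I.sub_mem hi (I.mul_mem_right _ _ hi), j + i * e,
    J.add_mem hj (J.mul_mem_left _ _ he), by abel, hcI, ?_⟩
  calc ‖j + i * e‖ = ‖(i + j) - (i - i * e)‖ := by congr 1; abel
    _ ≤ ‖i + j‖ + ‖i - i * e‖ := norm_sub_le _ _
    _ ≤ (2 + ε) * ‖i + j‖ := by linarith
end

section
/- Let X be a locally compact Hausdorff space and H a complex Hilbert space, and let A = C₀(X, K(H)). Let B ⊆ A be a norm-closed star-subalgebra with the property that for all closed subsets Y, Z ⊆ X one has J_Y + J_Z = J_{Y∩Z}, where for a closed set Y ⊆ X we write J_Y = {b ∈ B : b(y) = 0 for all y ∈ Y}. Then B is a C_b(X)-submodule of A: for every bounded continuous function f : X → ℂ and every b ∈ B, the pointwise product f·b belongs to B. (Elliott–Olesen.) -/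
open scoped ZeroAtInfty
open BoundedContinuousFunction

section CStarAlgebra

variable {A ι : Type*} [CStarAlgebra A]

theorem norm_sum_real_smul_le [PartialOrder A] [StarOrderedRing A] (s : Finset ι) (q : ι → A)
    (hq : ∀ i ∈ s, 0 ≤ q i) (m : ι → ℝ) {η : ℝ} (hη : 0 ≤ η)
    (hm : ∀ i ∈ s, q i = 0 ∨ |m i| ≤ η) :
    ‖∑ i ∈ s, m i • q i‖ ≤ 3 * η * ‖∑ i ∈ s, q i‖ := by
  have heq : ∑ i ∈ s, m i • q i = ∑ i ∈ s, (m i + η) • q i - η • ∑ i ∈ s, q i := by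
    simp [add_smul, Finset.sum_add_distrib, Finset.smul_sum]
  have h0 : 0 ≤ ∑ i ∈ s, (m i + η) • q i := Finset.sum_nonneg fun i hi => by
    rcases hm i hi with h | h
    · simp [h]
    · exact smul_nonneg (by linarith [neg_le_of_abs_le h]) (hq i hi)
  have h1 : ∑ i ∈ s, (m i + η) • q i ≤ (2 * η) • ∑ i ∈ s, q i := by
    rw [Finset.smul_sum]
    refine Finset.sum_le_sum fun i hi => ?_
    rcases hm i hi with h | h
    · simp [h]
    · exact smul_le_smul_of_nonneg_right (by linarith [le_of_abs_le h]) (hq i hi)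
  have h2 := CStarAlgebra.norm_le_norm_of_nonneg_of_le h0 h1
  rw [norm_smul, Real.norm_of_nonneg (by positivity)] at h2
  have h3 : ‖η • ∑ i ∈ s, q i‖ = η * ‖∑ i ∈ s, q i‖ := by
    rw [norm_smul, Real.norm_of_nonneg hη]
  rw [heq]
  refine (norm_sub_le _ _).trans ?_
  linarith

theorem norm_sum_smul_le [PartialOrder A] [StarOrderedRing A] (s : Finset ι) (q : ι → A)
    (hq : ∀ i ∈ s, 0 ≤ q i) (m : ι → ℂ) {η : ℝ} (hη : 0 ≤ η)
    (hm : ∀ i ∈ s, q i = 0 ∨ ‖m i‖ ≤ η) :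
    ‖∑ i ∈ s, m i • q i‖ ≤ 6 * η * ‖∑ i ∈ s, q i‖ := by
  have heq : ∑ i ∈ s, m i • q i =
      ∑ i ∈ s, (m i).re • q i + Complex.I • ∑ i ∈ s, (m i).im • q i := by
    rw [Finset.smul_sum, ← Finset.sum_add_distrib]
    refine Finset.sum_congr rfl fun i _ => ?_
    rw [← Complex.coe_smul, ← Complex.coe_smul, smul_smul, ← add_smul, mul_comm Complex.I,
      Complex.re_add_im]
  have hre := norm_sum_real_smul_le s q hq (fun i => (m i).re) hη
    fun i hi => (hm i hi).imp_right (Complex.abs_re_le_norm _).trans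
  have him := norm_sum_real_smul_le s q hq (fun i => (m i).im) hη
    fun i hi => (hm i hi).imp_right (Complex.abs_im_le_norm _).trans
  rw [heq]
  refine (norm_add_le _ _).trans ?_
  rw [norm_smul, Complex.norm_I, one_mul]
  linarith

/-- Given finitely many elements `a i`, the elements `k * a i * star (a i) * k` for
`k = (∑ a i * star (a i) + δ)^(-1/2)` form a contractive approximate partition of unity acting
almost as the identity on `∑ a i`. -/
theorem exists_conjugate_sum_norm_le (s : Finset ι) (a : ι → A) {ε : ℝ} (hε : 0 < ε) :
    ∃ k ∈ StarAlgebra.elemental ℝ (∑ i ∈ s, a i * star (a i)), IsSelfAdjoint k ∧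
      ‖∑ i ∈ s, k * (a i * star (a i)) * k‖ ≤ 1 ∧
      ‖(1 - ∑ i ∈ s, k * (a i * star (a i)) * k) * ∑ i ∈ s, a i‖ ≤ ε := by
  let := CStarAlgebra.spectralOrder A
  have := CStarAlgebra.spectralOrderedRing A
  set h := ∑ i ∈ s, a i * star (a i) with h_def
  have h_nonneg : 0 ≤ h := Finset.sum_nonneg fun i _ => mul_star_self_nonneg _
  set n : ℝ := (s.card : ℝ)
  have hn : 0 ≤ n := by positivity
  obtain ⟨r, hr, hrn⟩ : ∃ r : ℝ, 0 < r ∧ r * n ≤ ε := by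
    refine ⟨ε / (n + 1), by positivity, ?_⟩
    rw [div_mul_eq_mul_div, div_le_iff₀ (by positivity)]
    nlinarith
  set φ : ℝ → ℝ := fun t => (√(t + r ^ 2))⁻¹
  have hsa : IsSelfAdjoint h := h_nonneg.isSelfAdjoint
  have hspec : ∀ t ∈ spectrum ℝ h, 0 ≤ t := fun t ht => spectrum_nonneg_of_nonneg h_nonneg ht
  have hpos : ∀ t ∈ spectrum ℝ h, 0 < t + r ^ 2 := fun t ht => by
    have := hspec t ht
    positivity
  have hφ : ContinuousOn φ (spectrum ℝ h) := by
    refine ContinuousOn.inv₀ (by fun_prop) fun t ht => ?_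
    exact (Real.sqrt_pos.2 (hpos t ht)).ne'
  set k := cfc φ h
  have hk : IsSelfAdjoint k := cfc_predicate φ h
  have hsum : ∑ i ∈ s, k * (a i * star (a i)) * k = k * h * k := by
    rw [h_def, Finset.mul_sum, Finset.sum_mul]
  have hkhk : k * h * k = 1 - r ^ 2 • (k * k) := by
    have h1 : k * h * k = cfc (fun t => φ t * t * φ t) h := by
      rw [cfc_mul (fun t => φ t * t) φ h (by fun_prop) hφ, cfc_mul φ (fun t => t) h hφ (by fun_prop),
        cfc_id' ℝ h hsa]
    have h2 : 1 - r ^ 2 • (k * k) = cfc (fun t => 1 - r ^ 2 • (φ t * φ t)) h := by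
      rw [cfc_sub (fun _ => 1) (fun t => r ^ 2 • (φ t * φ t)) h (by fun_prop) (by fun_prop),
        cfc_smul (r ^ 2) (fun t => φ t * φ t) h (by fun_prop), cfc_mul φ φ h hφ hφ,
        cfc_const_one ℝ h hsa]
    rw [h1, h2]
    refine cfc_congr fun t ht => ?_
    have hp := hpos t ht
    have : φ t * φ t = (t + r ^ 2)⁻¹ := by
      simp only [φ]
      rw [← mul_inv, Real.mul_self_sqrt hp.le]
    rw [smul_eq_mul, mul_right_comm, this]
    field_simp
    ring
  have hkk : 0 ≤ k * k := hk.mul_self_nonneg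
  have hle : k * h * k ≤ 1 := by
    rw [hkhk]
    exact sub_le_self _ (smul_nonneg (by positivity) hkk)
  have hnonneg : ∀ i, 0 ≤ k * (a i * star (a i)) * k := fun i =>
    hk.conjugate_nonneg (mul_star_self_nonneg _)
  have hkh_nonneg : 0 ≤ k * h * k := hk.conjugate_nonneg h_nonneg
  have hka : ∀ i ∈ s, ‖k * a i‖ ≤ 1 := fun i hi => by
    have h1 : k * (a i * star (a i)) * k ≤ 1 :=
      (Finset.single_le_sum (fun j _ => hnonneg j) hi).trans (hsum.trans_le hle)
    have h2 : k * (a i * star (a i)) * k = k * a i * star (k * a i) := by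
      rw [star_mul, hk.star_eq]; noncomm_ring
    have h3 := (CStarAlgebra.norm_le_one_iff_of_nonneg _ (hnonneg i)).2 h1
    rw [h2, CStarRing.norm_self_mul_star] at h3
    nlinarith [norm_nonneg (k * a i)]
  have hrk : r * ‖k‖ ≤ 1 := by
    have h1 : r ^ 2 • (k * k) ≤ 1 := by
      have : 0 ≤ 1 - r ^ 2 • (k * k) := hkhk ▸ hkh_nonneg
      exact sub_nonneg.1 this
    have h2 := (CStarAlgebra.norm_le_one_iff_of_nonneg _ (smul_nonneg (by positivity) hkk)).2 h1
    rw [norm_smul, Real.norm_of_nonneg (by positivity), hk.norm_mul_self] at h2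
    have : (r * ‖k‖) ^ 2 ≤ 1 := by rw [mul_pow]; exact h2
    exact (sq_le_one_iff₀ (by positivity)).1 this
  refine ⟨k, cfc_mem_elemental φ h, hk, ?_, ?_⟩
  · rw [hsum]
    exact (CStarAlgebra.norm_le_one_iff_of_nonneg _ hkh_nonneg).2 hle
  · rw [hsum, hkhk, sub_sub_cancel, smul_mul_assoc, mul_assoc, Finset.mul_sum, norm_smul,
      Real.norm_of_nonneg (by positivity)]
    have h1 : ‖∑ i ∈ s, k * a i‖ ≤ n := by
      simpa [n] using norm_sum_le_of_le s hka
    calc r ^ 2 * ‖k * ∑ i ∈ s, k * a i‖ ≤ r ^ 2 * (‖k‖ * n) := by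
          gcongr
          exact (norm_mul_le _ _).trans (by gcongr)
      _ = (r * ‖k‖) * (r * n) := by ring
      _ ≤ 1 * (r * n) := by gcongr
      _ ≤ ε := by linarith

/-- The elements `k` such that `k` and `star k` map the subspace `V` into itself by left
multiplication. -/
def leftStarMultipliers (V : Submodule ℂ A) : StarSubalgebra ℝ A where
  carrier := {k | ∀ b ∈ V, k * b ∈ V ∧ star k * b ∈ V}
  mul_mem' {k l} hk hl b hb := by
    rw [star_mul, mul_assoc, mul_assoc]
    exact ⟨(hk _ (hl b hb).1).1, (hl _ (hk b hb).2).2⟩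
  add_mem' {k l} hk hl b hb := by
    rw [star_add, add_mul, add_mul]
    exact ⟨V.add_mem (hk b hb).1 (hl b hb).1, V.add_mem (hk b hb).2 (hl b hb).2⟩
  algebraMap_mem' r b hb := by
    have h : algebraMap ℝ A r * b ∈ V := by
      rw [← Algebra.smul_def, ← Complex.coe_smul]
      exact V.smul_mem _ hb
    exact ⟨h, by rwa [← algebraMap_star_comm, star_trivial]⟩
  star_mem' {k} hk b hb := ⟨(hk b hb).2, by rw [star_star]; exact (hk b hb).1⟩

theorem isClosed_leftStarMultipliers {V : Submodule ℂ A} (hV : IsClosed (V : Set A)) :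
    IsClosed (leftStarMultipliers V : Set A) := by
  have : (leftStarMultipliers V : Set A) =
      ⋂ b ∈ V, {k | k * b ∈ V} ∩ {k | star k * b ∈ V} := by
    ext k
    simp [leftStarMultipliers, forall_and]
  rw [this]
  refine isClosed_biInter fun b _ => IsClosed.inter ?_ ?_
  · exact hV.preimage (continuous_id.mul continuous_const)
  · exact hV.preimage (continuous_star.mul continuous_const)

end CStarAlgebra

section FunctionAlgebra

variable {X A : Type*} [TopologicalSpace X] [CStarAlgebra A]

theorem exists_sum_eq_of_sum_property {ι : Type*} {V : Submodule ℂ (X →ᵇ A)}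
    (hV : ∀ Y Z : Set X, IsClosed Y → IsClosed Z → ∀ b ∈ V, (∀ y ∈ Y ∩ Z, b y = 0) →
      ∃ b₁ ∈ V, ∃ b₂ ∈ V, (∀ y ∈ Y, b₁ y = 0) ∧ (∀ z ∈ Z, b₂ z = 0) ∧ b = b₁ + b₂)
    (s : Finset ι) (Y : ι → Set X) (hY : ∀ i, IsClosed (Y i)) (b : X →ᵇ A) (hb : b ∈ V)
    (hbY : ∀ x, (∀ i ∈ s, x ∈ Y i) → b x = 0) :
    ∃ a : ι → (X →ᵇ A), (∀ i, a i ∈ V) ∧ (∀ i, ∀ x ∈ Y i, a i x = 0) ∧ b = ∑ i ∈ s, a i := by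
  classical
  induction s using Finset.induction_on generalizing b with
  | empty =>
    refine ⟨0, fun _ => V.zero_mem, fun _ _ _ => rfl, ?_⟩
    ext x
    simpa using hbY x (by simp)
  | insert i s hi ih =>
    obtain ⟨b₁, hb₁, b₂, hb₂, h₁, h₂, rfl⟩ := hV (Y i) (⋂ j ∈ s, Y j) (hY i)
      (isClosed_biInter fun j _ => hY j) b hb fun x hx => hbY x (by simpa using hx)
    obtain ⟨a, haV, haY, rfl⟩ := ih b₂ hb₂ fun x hx => h₂ x (by simpa using hx)
    refine ⟨Function.update a i b₁, fun j => ?_, fun j x hx => ?_, ?_⟩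
    · rcases eq_or_ne j i with rfl | hj
      · simpa
      · simpa [hj] using haV j
    · rcases eq_or_ne j i with rfl | hj
      · simpa using h₁ x hx
      · simpa [hj] using haY j x hx
    · rw [Finset.sum_insert hi, Function.update_self]
      congr 1
      refine Finset.sum_congr rfl fun j hj => ?_
      rw [Function.update_of_ne (ne_of_mem_of_not_mem hj hi)]

/-- A closed self-adjoint algebra of bounded functions satisfying `J_Y + J_Z = J_{Y ∩ Z}` is stable
under multiplication by bounded continuous scalar functions. -/
theorem smul_mem_of_sum_property {V : Submodule ℂ (X →ᵇ A)} (hclosed : IsClosed (V : Set (X →ᵇ A)))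
    (hmul : ∀ b ∈ V, ∀ c ∈ V, b * c ∈ V) (hstar : ∀ b ∈ V, star b ∈ V)
    (hV : ∀ Y Z : Set X, IsClosed Y → IsClosed Z → ∀ b ∈ V, (∀ y ∈ Y ∩ Z, b y = 0) →
      ∃ b₁ ∈ V, ∃ b₂ ∈ V, (∀ y ∈ Y, b₁ y = 0) ∧ (∀ z ∈ Z, b₂ z = 0) ∧ b = b₁ + b₂)
    (f : X →ᵇ ℂ) (b : X →ᵇ A) (hb : b ∈ V) : f • b ∈ V := by
  let := CStarAlgebra.spectralOrder A
  have := CStarAlgebra.spectralOrderedRing A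
  refine hclosed.closure_subset (Metric.mem_closure_iff.2 fun ε hε => ?_)
  obtain ⟨η, hη, hηε⟩ : ∃ η : ℝ, 0 < η ∧ 6 * η * ‖b‖ + ‖f‖ * η < ε := by
    refine ⟨ε / (6 * ‖b‖ + ‖f‖ + 1), by positivity, ?_⟩
    have : 6 * (ε / (6 * ‖b‖ + ‖f‖ + 1)) * ‖b‖ + ‖f‖ * (ε / (6 * ‖b‖ + ‖f‖ + 1)) =
        ε * (6 * ‖b‖ + ‖f‖) / (6 * ‖b‖ + ‖f‖ + 1) := by ring
    rw [this, div_lt_iff₀ (by positivity)]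
    linarith
  obtain ⟨t, ht, hft⟩ := Metric.totallyBounded_iff.1
    (Metric.isCompact_of_isClosed_isBounded isClosed_closure
      (show Bornology.IsBounded (Set.range f) from f.isBounded_range).closure).totallyBounded η hη
  lift t to Finset ℂ using ht
  let Y : ℂ → Set X := fun z => {x | η ≤ dist (f x) z}
  have hY : ∀ z, IsClosed (Y z) := fun z =>
    isClosed_le continuous_const (f.continuous.dist continuous_const)
  obtain ⟨a, haV, haY, hba⟩ := exists_sum_eq_of_sum_property hV t Y hY b hb fun x hx => by
    obtain ⟨z, hz, hxz⟩ := Set.mem_iUnion₂.1 (hft (subset_closure (Set.mem_range_self x)))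
    exact absurd (Metric.mem_ball.1 hxz) (not_lt.2 (hx z hz))
  obtain ⟨k, hk_mem, hk, hsum, hsub⟩ := exists_conjugate_sum_norm_le t a hη
  have hkV : k ∈ leftStarMultipliers V := by
    refine StarAlgebra.elemental.le_of_mem (isClosed_leftStarMultipliers hclosed) ?_ hk_mem
    refine sum_mem fun z _ c hc => ?_
    have := hmul _ (hmul _ (haV z) _ (hstar _ (haV z))) c hc
    exact ⟨this, by rwa [star_mul, star_star]⟩
  set q : ℂ → (X →ᵇ A) := fun z => k * (a z * star (a z)) * k with hq
  have hqV : ∀ z, q z * b ∈ V := fun z => by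
    simp only [hq, mul_assoc]
    exact (hkV _ (hmul _ (haV z) _ (hmul _ (hstar _ (haV z)) _ (hkV b hb).1))).1
  refine ⟨∑ z ∈ t, z • (q z * b), V.sum_mem fun z _ => V.smul_mem _ (hqV z), ?_⟩
  rw [dist_eq_norm]
  refine lt_of_le_of_lt ((BoundedContinuousFunction.norm_le (by positivity)).2 fun x => ?_) hηε
  have heval : ∀ g : ℂ → (X →ᵇ A), (∑ z ∈ t, g z) x = ∑ z ∈ t, g z x := fun g => by simp
  have hkx : IsSelfAdjoint (k x) := DFunLike.congr_fun hk.star_eq x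
  have hqx : ∀ z ∈ t, 0 ≤ q z x := fun z _ => hkx.conjugate_nonneg (mul_star_self_nonneg (a z x))
  have hdecomp : (f • b - ∑ z ∈ t, z • (q z * b)) x =
      (∑ z ∈ t, (f x - z) • q z x) * b x + f x • ((1 - ∑ z ∈ t, q z) * b) x := by
    simp only [coe_sub, coe_mul, Pi.sub_apply, Pi.mul_apply, heval,
      sub_smul, Finset.sum_sub_distrib, sub_mul, smul_sub, one_mul, ← Finset.smul_sum,
      smul_mul_assoc, Finset.sum_mul]
    have : (f • b) x = f x • b x := rfl
    rw [this]
    simp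
  have h1 : ‖∑ z ∈ t, (f x - z) • q z x‖ ≤ 6 * η := by
    refine (norm_sum_smul_le t (fun z => q z x) hqx (fun z => f x - z) hη.le fun z _ => ?_).trans ?_
    · by_cases hx : x ∈ Y z
      · left
        simp [hq, haY z x hx]
      · right
        rw [← dist_eq_norm]
        exact (not_le.1 hx).le
    · rw [← heval]
      have := (norm_coe_le_norm (∑ z ∈ t, q z) x).trans hsum
      nlinarith
  have h2 : ‖((1 - ∑ z ∈ t, q z) * b) x‖ ≤ η := by
    refine (norm_coe_le_norm _ x).trans ?_
    rw [hba]
    exact hsub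
  rw [hdecomp]
  refine norm_add_le_of_le ?_ ?_
  · refine (norm_mul_le _ _).trans ?_
    gcongr
    exact norm_coe_le_norm b x
  · rw [norm_smul]
    gcongr
    exact norm_coe_le_norm f x

end FunctionAlgebra

/-- **Elliott–Olesen.** Let `A = C₀(X, K(H))` and let `B ⊆ A` be a norm-closed star-subalgebra
such that `J_Y + J_Z = J_{Y ∩ Z}` for all closed `Y, Z ⊆ X`, where
`J_Y = {b ∈ B : b(y) = 0 for all y ∈ Y}`. Then `B` is a `C_b(X)`-submodule of `A`: the pointwise
product of a bounded continuous function with an element of `B` again lies in `B`. -/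
theorem elliott_olesen
    {X : Type} [TopologicalSpace X] [LocallyCompactSpace X] [T2Space X]
    {H : Type} [NormedAddCommGroup H] [InnerProductSpace ℂ H] [CompleteSpace H]
    (B : Set C₀(X, H →L[ℂ] H))
    (hB_compact : ∀ b ∈ B, ∀ x : X, IsCompactOperator (b x))
    (hB_closed : IsClosed B)
    (h_zero : (0 : C₀(X, H →L[ℂ] H)) ∈ B)
    (h_add : ∀ b ∈ B, ∀ c ∈ B, b + c ∈ B)
    (h_smul : ∀ (z : ℂ), ∀ b ∈ B, z • b ∈ B)
    (h_mul : ∀ b ∈ B, ∀ c ∈ B, b * c ∈ B)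
    (h_star : ∀ b ∈ B, star b ∈ B)
    (h_sum : ∀ Y Z : Set X, IsClosed Y → IsClosed Z →
      {b : C₀(X, H →L[ℂ] H) |
          ∃ b₁ ∈ B, ∃ b₂ ∈ B, (∀ y ∈ Y, b₁ y = 0) ∧ (∀ z ∈ Z, b₂ z = 0) ∧ b = b₁ + b₂} =
        {b : C₀(X, H →L[ℂ] H) | b ∈ B ∧ ∀ y ∈ Y ∩ Z, b y = 0}) :
    ∀ f : BoundedContinuousFunction X ℂ, ∀ b ∈ B,
      ∃ c ∈ B, ∀ x : X, c x = f x • b x := by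
  intro f b hb
  let V : Submodule ℂ (X →ᵇ (H →L[ℂ] H)) :=
    { carrier := ZeroAtInftyContinuousMap.toBCF '' B
      zero_mem' := ⟨0, h_zero, rfl⟩
      add_mem' := by
        rintro _ _ ⟨b, hb, rfl⟩ ⟨c, hc, rfl⟩
        exact ⟨b + c, h_add b hb c hc, rfl⟩
      smul_mem' := by
        rintro z _ ⟨b, hb, rfl⟩
        exact ⟨z • b, h_smul z b hb, rfl⟩ }
  have hV_closed : IsClosed (V : Set (X →ᵇ (H →L[ℂ] H))) :=
    ((ZeroAtInftyContinuousMap.isometry_toBCF).isClosedEmbedding.isClosedMap) B hB_closed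
  have hV_mul : ∀ b ∈ V, ∀ c ∈ V, b * c ∈ V := by
    rintro _ ⟨b, hb, rfl⟩ _ ⟨c, hc, rfl⟩
    exact ⟨b * c, h_mul b hb c hc, rfl⟩
  have hV_star : ∀ b ∈ V, star b ∈ V := by
    rintro _ ⟨b, hb, rfl⟩
    exact ⟨star b, h_star b hb, rfl⟩
  obtain ⟨c, hc, hcf⟩ := smul_mem_of_sum_property hV_closed hV_mul hV_star (by
    rintro Y Z hY hZ _ ⟨d, hd, rfl⟩ hdYZ
    obtain ⟨b₁, hb₁, b₂, hb₂, h₁, h₂, rfl⟩ := (h_sum Y Z hY hZ).ge ⟨hd, hdYZ⟩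
    exact ⟨_, ⟨b₁, hb₁, rfl⟩, _, ⟨b₂, hb₂, rfl⟩, h₁, h₂, rfl⟩) f _ ⟨b, hb, rfl⟩
  exact ⟨c, hc, fun x => DFunLike.congr_fun hcf x⟩
end

section
/- Let X be a locally compact Hausdorff space and H a complex Hilbert space, and let A = C₀(X, K(H)). Let B ⊆ A be a norm-closed star-subalgebra such that (i) B is a C_b(X)-submodule of A, i.e. f·b ∈ B for every bounded continuous function f : X → ℂ and every b ∈ B, and (ii) for every x ∈ X the evaluation map is surjective: {b(x) : b ∈ B} equals the set of all compact operators on H. Then B = A. (Takahasi.) -/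
open scoped ZeroAtInfty

/-- A set of functions in `C₀(X, E)` closed under addition and multiplication by bounded
continuous functions contains in its closure every `k` whose values it
attains pointwise. -/
theorem exists_dist_le_of_pointwise_mem
    {X E : Type*} [TopologicalSpace X] [LocallyCompactSpace X] [T2Space X]
    [NormedAddCommGroup E] [NormedSpace ℂ E] (B : Set C₀(X, E))
    (h_zero : (0 : C₀(X, E)) ∈ B)
    (h_add : ∀ b ∈ B, ∀ c ∈ B, b + c ∈ B)
    (h_module : ∀ f : BoundedContinuousFunction X ℂ, ∀ b ∈ B,
      ∃ c ∈ B, ∀ x : X, c x = f x • b x)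
    (k : C₀(X, E)) (hk : ∀ x, ∃ b ∈ B, b x = k x) {ε : ℝ} (hε : 0 < ε) :
    ∃ b ∈ B, dist b k ≤ ε := by
  classical
  choose b hbB hbk using hk
  obtain ⟨K, hK, hKk⟩ : ∃ K : Set X, IsCompact K ∧ ∀ x ∉ K, ‖k x‖ < ε := by
    have h := k.zero_at_infty'.eventually (Metric.ball_mem_nhds 0 hε)
    obtain ⟨K, hK, hsub⟩ := Filter.mem_cocompact.mp h
    exact ⟨K, hK, fun x hx => by simpa using hsub hx⟩
  have hU : ∀ y, IsOpen {x | ‖b y x - k x‖ < ε} := fun y =>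
    isOpen_lt ((b y).continuous.sub k.continuous).norm continuous_const
  obtain ⟨t, ht⟩ := hK.elim_finite_subcover _ hU fun x _ =>
    Set.mem_iUnion.mpr ⟨x, by simpa [hbk] using hε⟩
  obtain ⟨f, hf, -⟩ := PartitionOfUnity.exists_isSubordinate_of_locallyFinite_t2space hK
    (fun y : t => {x | ‖b y x - k x‖ < ε}) (fun y => hU y) (locallyFinite_of_finite _)
    (fun x hx => by simpa using ht hx)
  have hc : ∀ y : t, ∃ c ∈ B, ∀ x, c x = ((f y x : ℝ) : ℂ) • b y x := fun y =>
    h_module (BoundedContinuousFunction.ofNormedAddCommGroup (fun x => ((f y x : ℝ) : ℂ))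
      (Complex.continuous_ofReal.comp (f y).continuous) 1 fun x => by
        simpa [abs_of_nonneg (f.nonneg y x)] using f.le_one y x) _ (hbB y)
  choose c hcB hcx using hc
  refine ⟨∑ y, c y, Finset.sum_induction _ (· ∈ B) (fun a d ha hd => h_add a ha d hd) h_zero
    fun y _ => hcB y, ?_⟩
  rw [← ZeroAtInftyContinuousMap.dist_toBCF_eq_dist, BoundedContinuousFunction.dist_le hε.le]
  intro x
  have hsum : (∑ y, c y : C₀(X, E)) x = ∑ y, ((f y x : ℝ) : ℂ) • b y x := by
    rw [← Finset.sum_congr rfl fun y _ => hcx y x]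
    exact map_sum (⟨⟨fun g : C₀(X, E) => g x, rfl⟩, fun _ _ => rfl⟩ : C₀(X, E) →+ E) c _
  have hle : ∑ y, f y x ≤ 1 := by
    rw [← finsum_eq_sum_of_fintype]; exact f.sum_le_one x
  have hrest : (1 - ∑ y, f y x) * ‖k x‖ ≤ (1 - ∑ y, f y x) * ε := by
    by_cases hx : x ∈ K
    · have h1 := f.sum_eq_one hx
      rw [finsum_eq_sum_of_fintype] at h1
      rw [h1, sub_self, zero_mul, zero_mul]
    · exact mul_le_mul_of_nonneg_left (hKk x hx).le (sub_nonneg.mpr hle)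
  have hterm : ∀ y : t, f y x * ‖b y x - k x‖ ≤ f y x * ε := fun y => by
    by_cases hx : f y x = 0
    · simp [hx]
    · exact mul_le_mul_of_nonneg_left
        (le_of_lt (hf y (subset_tsupport _ hx))) (f.nonneg y x)
  have hdecomp : ∑ y, ((f y x : ℝ) : ℂ) • b y x - k x
      = ∑ y, ((f y x : ℝ) : ℂ) • (b y x - k x) - ((1 - ∑ y, f y x : ℝ) : ℂ) • k x := by
    simp only [smul_sub, Finset.sum_sub_distrib, ← Finset.sum_smul]
    push_cast
    module
  change dist ((∑ y, c y : C₀(X, E)) x) (k x) ≤ ε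
  rw [dist_eq_norm, hsum, hdecomp]
  calc _ ≤ ∑ y, f y x * ‖b y x - k x‖ + (1 - ∑ y, f y x) * ‖k x‖ := by
        refine (norm_sub_le _ _).trans (add_le_add ((norm_sum_le _ _).trans_eq ?_) (le_of_eq ?_))
        · exact Finset.sum_congr rfl fun y _ => by
            rw [norm_smul, Complex.norm_real, Real.norm_of_nonneg (f.nonneg y x)]
        · rw [norm_smul, Complex.norm_real, Real.norm_of_nonneg (sub_nonneg.mpr hle)]
    _ ≤ ∑ y, f y x * ε + (1 - ∑ y, f y x) * ε :=
        add_le_add (Finset.sum_le_sum fun y _ => hterm y) hrest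
    _ = ε := by rw [← Finset.sum_mul]; ring

/-- **Takahasi.** Let `A = C₀(X, K(H))` and let `B ⊆ A` be a norm-closed star-subalgebra that
is a `C_b(X)`-submodule of `A` and such that each evaluation `b ↦ b(x)` maps `B` onto all of
`K(H)`. Then `B = A`. -/
theorem takahasi
    {X : Type} [TopologicalSpace X] [LocallyCompactSpace X] [T2Space X]
    {H : Type} [NormedAddCommGroup H] [InnerProductSpace ℂ H] [CompleteSpace H]
    (B : Set C₀(X, H →L[ℂ] H))
    (hB_compact : ∀ b ∈ B, ∀ x : X, IsCompactOperator (b x))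
    (hB_closed : IsClosed B)
    (h_zero : (0 : C₀(X, H →L[ℂ] H)) ∈ B)
    (h_add : ∀ b ∈ B, ∀ c ∈ B, b + c ∈ B)
    (h_smul : ∀ (z : ℂ), ∀ b ∈ B, z • b ∈ B)
    (h_mul : ∀ b ∈ B, ∀ c ∈ B, b * c ∈ B)
    (h_star : ∀ b ∈ B, star b ∈ B)
    (h_module : ∀ f : BoundedContinuousFunction X ℂ, ∀ b ∈ B,
      ∃ c ∈ B, ∀ x : X, c x = f x • b x)
    (h_surj : ∀ x : X,
      {T : H →L[ℂ] H | ∃ b ∈ B, b x = T} = {T : H →L[ℂ] H | IsCompactOperator T}) :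
    B = {k : C₀(X, H →L[ℂ] H) | ∀ x : X, IsCompactOperator (k x)} := by
  refine Set.Subset.antisymm hB_compact fun k hk => ?_
  rw [← hB_closed.closure_eq, Metric.mem_closure_iff]
  intro ε hε
  obtain ⟨b, hb, hbk⟩ := exists_dist_le_of_pointwise_mem B h_zero h_add h_module k
    (fun x => (h_surj x).ge (hk x)) (half_pos hε)
  exact ⟨b, hb, by rw [dist_comm]; linarith⟩
end

section
/- Let B be a C*-algebra and let E be a Hilbert B-module, i.e. a B-module equipped with a B-valued inner product ⟨·,·⟩ : E × E → B that is B-linear in the second variable, satisfies ⟨ξ, η·b⟩ = ⟨ξ, η⟩·b, ⟨η, ξ⟩ = ⟨ξ, η⟩*, ⟨ξ, ξ⟩ ≥ 0 with ⟨ξ, ξ⟩ = 0 only for ξ = 0, and such that E is complete in the norm ‖ξ‖ = ‖⟨ξ, ξ⟩‖^{1/2}. Then every element of E factors: for every ξ ∈ E there exist η ∈ E and b ∈ B with ξ = η·b. -/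
/-- Every nonnegative element of a C*-algebra is the fourth power of a self-adjoint element. -/
theorem exists_isSelfAdjoint_fourth_root {B : Type*} [NonUnitalCStarAlgebra B] (c : B) :
    ∃ s : B, IsSelfAdjoint s ∧ star c * c = s * s * (s * s) := by
  let _ := CStarAlgebra.spectralOrder B
  have _ := CStarAlgebra.spectralOrderedRing B
  refine ⟨CFC.sqrt (CFC.sqrt (star c * c)), (CFC.sqrt_nonneg _).isSelfAdjoint, ?_⟩
  rw [CFC.sqrt_mul_sqrt_self _ (CFC.sqrt_nonneg _),
    CFC.sqrt_mul_sqrt_self _ (star_mul_self_nonneg c)]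

/-- A self-adjoint element `s` of a C*-algebra is approximated by elements of the form `s² g`:
the functional calculus of `t ↦ t / (t² + δ²)` provides `g`. -/
theorem IsSelfAdjoint.exists_norm_sub_sq_mul_le {B : Type*} [NonUnitalCStarAlgebra B]
    {s : B} (hs : IsSelfAdjoint s) {δ : ℝ} (hδ : 0 < δ) :
    ∃ g : B, ‖s - s * s * g‖ ≤ δ := by
  have hpos (t : ℝ) : 0 < t ^ 2 + δ ^ 2 := by positivity
  have hf : Continuous fun t : ℝ => t / (t ^ 2 + δ ^ 2) :=
    continuous_id.div (by fun_prop) fun t => (hpos t).ne'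
  refine ⟨cfcₙ (fun t : ℝ => t / (t ^ 2 + δ ^ 2)) s, ?_⟩
  have key : s - s * s * cfcₙ (fun t : ℝ => t / (t ^ 2 + δ ^ 2)) s =
      cfcₙ (fun t : ℝ => t - t * t * (t / (t ^ 2 + δ ^ 2))) s := by
    rw [cfcₙ_sub (fun t : ℝ => t) (fun t : ℝ => t * t * (t / (t ^ 2 + δ ^ 2))) s,
      cfcₙ_mul (fun t : ℝ => t * t) (fun t : ℝ => t / (t ^ 2 + δ ^ 2)) s
        (by fun_prop) (by simp) hf.continuousOn (by simp),
      cfcₙ_mul (fun t : ℝ => t) (fun t : ℝ => t) s, cfcₙ_id' ℝ s]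
  rw [key]
  refine norm_cfcₙ_le fun t _ => ?_
  have h : t - t * t * (t / (t ^ 2 + δ ^ 2)) = t * δ ^ 2 / (t ^ 2 + δ ^ 2) := by
    have := (hpos t).ne'
    field_simp
    ring
  rw [h, Real.norm_eq_abs, abs_le, le_div_iff₀ (hpos t), div_le_iff₀ (hpos t)]
  constructor <;> nlinarith [mul_nonneg hδ.le (sq_nonneg (t - δ)),
    mul_nonneg hδ.le (sq_nonneg (t + δ)), mul_nonneg hδ.le (sq_nonneg t), pow_pos hδ 3]

/-- **Factorisation in Hilbert modules.** If `E` is a (right) Hilbert module over a C*-algebra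
`B` — a `B`-module with a `B`-valued inner product `ip`, `B`-linear in the second variable,
conjugate-symmetric, positive definite, and `E` complete in the norm `‖ξ‖ = ‖ip ξ ξ‖^{1/2}` —
then every element of `E` factors as `ξ = η • b` with `η ∈ E`, `b ∈ B`. -/
theorem hilbert_module_factorisation
    {B : Type} [NonUnitalCStarAlgebra B]
    {E : Type} [NormedAddCommGroup E] [CompleteSpace E]
    (smulB : E → B → E) (ip : E → E → B)
    -- right `B`-module axioms
    (h_smul_add : ∀ (ξ : E) (b₁ b₂ : B), smulB ξ (b₁ + b₂) = smulB ξ b₁ + smulB ξ b₂)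
    (h_add_smul : ∀ (ξ η : E) (b : B), smulB (ξ + η) b = smulB ξ b + smulB η b)
    (h_smul_mul : ∀ (ξ : E) (b₁ b₂ : B), smulB (smulB ξ b₁) b₂ = smulB ξ (b₁ * b₂))
    -- `B`-linearity of the inner product in the second variable
    (h_ip_add : ∀ ξ η₁ η₂ : E, ip ξ (η₁ + η₂) = ip ξ η₁ + ip ξ η₂)
    (h_ip_smul : ∀ (ξ η : E) (b : B), ip ξ (smulB η b) = ip ξ η * b)
    -- conjugate symmetry
    (h_ip_star : ∀ ξ η : E, ip η ξ = star (ip ξ η))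
    -- positivity and definiteness
    (h_pos : ∀ ξ : E, ∃ c : B, ip ξ ξ = star c * c)
    (h_definite : ∀ ξ : E, ip ξ ξ = 0 → ξ = 0)
    -- the norm of `E` (in which `E` is complete) is induced by the inner product
    (h_norm : ∀ ξ : E, ‖ξ‖ ^ 2 = ‖ip ξ ξ‖) :
    ∀ ξ : E, ∃ (η : E) (b : B), ξ = smulB η b := by
  intro ξ
  obtain ⟨c, hc⟩ := h_pos ξ
  obtain ⟨s, hs, hsc⟩ := exists_isSelfAdjoint_fourth_root c
  rw [hsc] at hc
  have smul_sub (x : E) (b₁ b₂ : B) : smulB x (b₁ - b₂) = smulB x b₁ - smulB x b₂ :=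
    map_sub (AddMonoidHom.mk' (smulB x) (h_smul_add x)) b₁ b₂
  have sub_smul (x y : E) (b : B) : smulB (x - y) b = smulB x b - smulB y b :=
    map_sub (AddMonoidHom.mk' (smulB · b) (h_add_smul · · b)) x y
  have ip_sub (x y z : E) : ip x (y - z) = ip x y - ip x z :=
    map_sub (AddMonoidHom.mk' (ip x) (h_ip_add x)) y z
  have sub_ip (x y z : E) : ip (x - y) z = ip x z - ip y z := by
    rw [h_ip_star z, ip_sub, star_sub, ← h_ip_star, ← h_ip_star]
  have smul_ip (x y : E) (b : B) : ip (smulB x b) y = star b * ip x y := by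
    rw [h_ip_star y, h_ip_smul, star_mul, ← h_ip_star]
  have norm_eq_of_ip {x : E} {b : B} (h : ip x x = star b * b) : ‖x‖ = ‖b‖ := by
    refine (sq_eq_sq₀ (norm_nonneg _) (norm_nonneg _)).1 ?_
    rw [h_norm, h, CStarRing.norm_star_mul_self, sq]
  have norm_smul (b : B) : ‖smulB ξ b‖ = ‖s * s * b‖ := norm_eq_of_ip <| by
    simp only [h_ip_smul, smul_ip, hc, star_mul, hs.star_eq, mul_assoc]
  have norm_sub_smul (b : B) : ‖smulB ξ b - ξ‖ = ‖s * s * b - s * s‖ := norm_eq_of_ip <| by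
    simp only [ip_sub, sub_ip, h_ip_smul, smul_ip, hc, star_mul, star_sub, hs.star_eq, mul_sub,
      sub_mul, mul_assoc]
  have norm_smul_le (x : E) (b : B) : ‖smulB x b‖ ≤ ‖x‖ * ‖b‖ := by
    refine le_of_sq_le_sq ?_ (by positivity)
    calc ‖smulB x b‖ ^ 2 = ‖star b * ip x x * b‖ := by rw [h_norm, h_ip_smul, smul_ip]
      _ ≤ ‖star b‖ * ‖ip x x‖ * ‖b‖ := norm_mul₃_le
      _ = (‖x‖ * ‖b‖) ^ 2 := by rw [norm_star, ← h_norm]; ring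
  choose g hg using fun n : ℕ => hs.exists_norm_sub_sq_mul_le (δ := 1 / ((n : ℝ) + 1))
    Nat.one_div_pos_of_nat
  have hlim : Filter.Tendsto (fun n => s * s * g n) Filter.atTop (nhds s) :=
    tendsto_iff_norm_sub_tendsto_zero.2 <| squeeze_zero (fun _ => norm_nonneg _)
      (fun n => (norm_sub_rev _ _).trans_le (hg n)) tendsto_one_div_add_atTop_nhds_zero_nat
  have hcauchy : CauchySeq fun n => smulB ξ (g n) := by
    have h := Metric.cauchySeq_iff.1 hlim.cauchySeq
    simp only [dist_eq_norm, ← mul_sub, ← norm_smul, smul_sub] at h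
    exact Metric.cauchySeq_iff.2 (by simpa only [dist_eq_norm] using h)
  obtain ⟨η, hη⟩ := cauchySeq_tendsto_of_complete hcauchy
  refine ⟨η, s, tendsto_nhds_unique (f := fun n => smulB (smulB ξ (g n)) s)
    (l := Filter.atTop) ?_ ?_⟩
  · rw [tendsto_iff_norm_sub_tendsto_zero]
    simp only [h_smul_mul, norm_sub_smul]
    rw [← tendsto_iff_norm_sub_tendsto_zero]
    simpa only [mul_assoc] using hlim.mul_const s
  · rw [tendsto_iff_norm_sub_tendsto_zero]
    refine squeeze_zero (fun _ => norm_nonneg _) (fun n => ?_)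
      (by simpa using (tendsto_iff_norm_sub_tendsto_zero.1 hη).mul_const ‖s‖)
    rw [← sub_smul]
    exact norm_smul_le _ _
end

section
/- Let X be a locally compact Hausdorff space, let H be a nonzero complex Hilbert space, let A = C₀(X, K(H)), and let π be a nonzero star-algebra homomorphism from A to B(H') for some complex Hilbert space H', which is irreducible in the sense that H' ≠ 0 and the only closed subspaces of H' invariant under π(k) for every k ∈ A are 0 and H'. Then there exists a unique x ∈ X such that π is unitarily equivalent to the evaluation representation ev_x : k ↦ k(x); that is, there is a unitary u : H → H' with π(k) = u ∘ k(x) ∘ u⁻¹ for all k ∈ A, and no unitary with this intertwining property exists for any other point of X. -/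
open scoped ZeroAtInfty
open InnerProductSpace (rankOne)

section CompactOperators

variable {H H' : Type*} [NormedAddCommGroup H] [InnerProductSpace ℂ H]
  [NormedAddCommGroup H'] [InnerProductSpace ℂ H']

/-- A compact operator into an inner product space is approximated in norm by its compressions to
finite-dimensional subspaces. -/
theorem IsCompactOperator.exists_norm_sub_starProjection_comp_le_s19 {T : H' →L[ℂ] H}
    (hT : IsCompactOperator T) {ε : ℝ} (hε : 0 < ε) :
    ∃ (V : Submodule ℂ H) (_ : FiniteDimensional ℂ V), ‖T - V.starProjection ∘L T‖ ≤ ε := by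
  obtain ⟨K, hK, hTK⟩ := hT.image_closedBall_subset_compact 1
  obtain ⟨t, ht, htK⟩ := Metric.totallyBounded_iff.1 hK.totallyBounded ε hε
  have := FiniteDimensional.span_of_finite ℂ ht
  refine ⟨Submodule.span ℂ t, this, ContinuousLinearMap.opNorm_le_of_unit_norm hε.le fun v hv ↦ ?_⟩
  obtain ⟨w, hw, hwv⟩ := Set.mem_iUnion₂.1 (htK (hTK ⟨v, by simp [hv], rfl⟩))
  rw [Metric.mem_ball, dist_eq_norm] at hwv
  set V := Submodule.span ℂ t
  have hwV : V.starProjection w = w :=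
    Submodule.starProjection_eq_self_iff.2 (Submodule.subset_span hw)
  calc ‖(T - V.starProjection ∘L T) v‖ = ‖Vᗮ.starProjection (T v - w)‖ := by
        rw [Submodule.starProjection_orthogonal']
        simp [hwV]
    _ ≤ ‖Vᗮ.starProjection‖ * ‖T v - w‖ := ContinuousLinearMap.le_opNorm _ _
    _ ≤ 1 * ‖T v - w‖ := by gcongr; exact Submodule.starProjection_norm_le _
    _ ≤ ε := by simpa using hwv.le

theorem isCompactOperator_rankOne (x : H) (y : H') : IsCompactOperator (rankOne ℂ x y) :=
  (isCompactOperator_of_locallyCompactSpace_rng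
    (ContinuousLinearMap.toSpanSingleton ℂ x)).comp_clm (innerSL ℂ y)

theorem IsCompactOperator.adjoint [CompleteSpace H] [CompleteSpace H'] {T : H' →L[ℂ] H}
    (hT : IsCompactOperator T) : IsCompactOperator (ContinuousLinearMap.adjoint T) := by
  refine isClosed_setOfPred_isCompactOperator.closure_subset
    (Metric.mem_closure_iff.2 fun ε hε ↦ ?_)
  obtain ⟨V, _, hV⟩ := hT.exists_norm_sub_starProjection_comp_le_s19 (half_pos hε)
  refine ⟨ContinuousLinearMap.adjoint (V.starProjection ∘L T), ?_, ?_⟩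
  · rw [ContinuousLinearMap.adjoint_comp, ContinuousLinearMap.isSelfAdjoint_iff'.1
      (isSelfAdjoint_starProjection V)]
    have : IsCompactOperator V.starProjection :=
      (isCompactOperator_of_locallyCompactSpace_rng V.subtypeL).comp_clm
        V.orthogonalProjectionOnto
    exact this.clm_comp (ContinuousLinearMap.adjoint T)
  · rw [dist_eq_norm, ← map_sub, LinearIsometryEquiv.norm_map]
    exact hV.trans_lt (half_lt_self hε)

variable (H) in
/-- The C⋆-algebra of compact operators on a Hilbert space. -/
def compactOperators [CompleteSpace H] : NonUnitalStarSubalgebra ℂ (H →L[ℂ] H) where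
  carrier := {T | IsCompactOperator T}
  add_mem' hS hT := IsCompactOperator.add hS hT
  zero_mem' := isCompactOperator_zero
  mul_mem' {_ T} hS _ := IsCompactOperator.comp_clm hS T
  smul_mem' c _ hT := IsCompactOperator.smul hT c
  star_mem' hT := IsCompactOperator.adjoint hT

variable [CompleteSpace H]

instance isClosed_compactOperators : IsClosed (compactOperators H : Set (H →L[ℂ] H)) :=
  isClosed_setOfPred_isCompactOperator

/-- Rank-one operators as elements of the algebra of compact operators. -/
noncomputable def compactRankOne (x y : H) : compactOperators H :=
  ⟨rankOne ℂ x y, isCompactOperator_rankOne x y⟩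

theorem mul_compactRankOne (T : compactOperators H) (x y : H) :
    T * compactRankOne x y = compactRankOne (T.1 x) y :=
  Subtype.ext (InnerProductSpace.comp_rankOne x y T.1)

theorem compactRankOne_mul_compactRankOne (x y z w : H) :
    compactRankOne x y * compactRankOne z w = inner ℂ y z • compactRankOne x w :=
  Subtype.ext (InnerProductSpace.rankOne_comp_rankOne x y z w)

theorem star_compactRankOne (x y : H) : star (compactRankOne x y) = compactRankOne y x :=
  Subtype.ext (InnerProductSpace.adjoint_rankOne x y)

theorem compactRankOne_mul (x y : H) (T : compactOperators H) :
    compactRankOne x y * T = compactRankOne x ((star T).1 y) := by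
  rw [← star_star (compactRankOne x y * T), star_mul, star_compactRankOne, mul_compactRankOne,
    star_compactRankOne]

variable [CompleteSpace H']

/-- A representation of the compact operators that kills all rank-one operators is zero. -/
theorem compactOperators.hom_eq_zero_of_rankOne (σ : compactOperators H →⋆ₙₐ[ℂ] (H' →L[ℂ] H'))
    (h : ∀ x y, σ (compactRankOne x y) = 0) (T : compactOperators H) : σ T = 0 := by
  refine norm_le_zero_iff.1 (le_of_forall_pos_le_add fun ε hε ↦ ?_)
  obtain ⟨V, _, hV⟩ :=
    IsCompactOperator.exists_norm_sub_starProjection_comp_le_s19 (T := T.1) T.2 hε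
  let b := stdOrthonormalBasis ℂ V
  let P : compactOperators H := ∑ i, compactRankOne (b i : H) (b i)
  have hP : P.1 = V.starProjection := by
    rw [b.starProjection_eq_sum_rankOne]
    exact AddSubmonoidClass.coe_finsetSum _ _
  have hPT : σ (P * T) = 0 := by
    simp [P, Finset.sum_mul, compactRankOne_mul, h, map_sum]
  calc ‖σ T‖ = ‖σ (T - P * T)‖ := by rw [map_sub, hPT, sub_zero]
    _ ≤ ‖T - P * T‖ := NonUnitalStarAlgHom.norm_apply_le σ _
    _ = ‖T.1 - V.starProjection ∘L T.1‖ := by rw [← hP]; rfl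
    _ ≤ 0 + ε := by simpa using hV

/-- Every nonzero irreducible representation of the compact operators is unitarily equivalent to
the identity representation. -/
theorem compactOperators.exists_linearIsometryEquiv_of_irreducible
    (σ : compactOperators H →⋆ₙₐ[ℂ] (H' →L[ℂ] H')) (hσ : ∃ T, σ T ≠ 0)
    (hirr : ∀ V : Submodule ℂ H', IsClosed (V : Set H') → (∀ T, ∀ v ∈ V, σ T v ∈ V) →
      V = ⊥ ∨ V = ⊤) :
    ∃ u : H ≃ₗᵢ[ℂ] H', ∀ T ξ, σ T ξ = u (T.1 (u.symm ξ)) := by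
  obtain ⟨x, y, hxy⟩ : ∃ x y, σ (compactRankOne x y) ≠ 0 := by
    by_contra! h
    exact hσ.elim fun T hT ↦ hT (compactOperators.hom_eq_zero_of_rankOne σ h T)
  obtain ⟨w, hw⟩ : ∃ w, σ (compactRankOne x y) w ≠ 0 := by
    by_contra! h
    exact hxy (ContinuousLinearMap.ext h)
  have hy : y ≠ 0 := by
    rintro rfl
    refine hxy ?_
    rw [show compactRankOne x 0 = (0 : compactOperators H) from
      Subtype.ext (by simp [compactRankOne]), map_zero]
  obtain ⟨e, he, v₀, hv₀⟩ : ∃ e : H, ‖e‖ = 1 ∧ ∃ v, σ (compactRankOne e e) v ≠ 0 := by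
    have hn : (‖y‖ : ℂ) ≠ 0 := by simpa using hy
    refine ⟨((‖y‖ : ℂ)⁻¹) • y, by simp [norm_smul, hy], w, fun h ↦ hw ?_⟩
    have h1 : compactRankOne x y =
        compactRankOne x y * compactRankOne ((‖y‖ : ℂ)⁻¹ • y) ((‖y‖ : ℂ)⁻¹ • y) := by
      rw [compactRankOne_mul_compactRankOne]
      refine Subtype.ext ?_
      simp only [compactRankOne, NonUnitalStarSubalgebra.coe_smul, inner_smul_right,
        inner_self_eq_norm_sq_to_K, map_smulₛₗ, smul_smul]
      have h2 : (‖y‖ : ℂ)⁻¹ * (‖y‖ : ℂ) ^ 2 * (‖y‖ : ℂ)⁻¹ = 1 := by field_simp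
      simp [h2]
    rw [h1, map_mul, mul_apply_eq_comp, h, map_zero]
  have hee : inner ℂ e e = (1 : ℂ) := by simp [inner_self_eq_norm_sq_to_K, he]
  have hidem : compactRankOne e e * compactRankOne e e = compactRankOne e e := by
    rw [compactRankOne_mul_compactRankOne, hee, one_smul]
  obtain ⟨v, hv, hev⟩ : ∃ v, ‖v‖ = 1 ∧ σ (compactRankOne e e) v = v := by
    set v₁ := σ (compactRankOne e e) v₀
    refine ⟨((‖v₁‖ : ℂ)⁻¹) • v₁, by simp [norm_smul, hv₀], ?_⟩
    rw [map_smul, ← mul_apply_eq_comp, ← map_mul, hidem]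
  let u₀ : H →ₗᵢ[ℂ] H' := LinearMap.isometryOfInner
    { toFun := fun z ↦ σ (compactRankOne z e) v
      map_add' := fun z z' ↦ by
        rw [← add_apply, ← map_add]
        congr 2
        exact Subtype.ext (by simp [compactRankOne])
      map_smul' := fun c z ↦ by
        rw [RingHom.id_apply, ← smul_apply, ← map_smul]
        congr 2
        exact Subtype.ext (by simp [compactRankOne]) } fun z z' ↦ by
      change inner ℂ (σ (compactRankOne z e) v) (σ (compactRankOne z' e) v) = _
      rw [← ContinuousLinearMap.adjoint_inner_right, ← ContinuousLinearMap.star_eq_adjoint,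
        ← map_star, star_compactRankOne, ← mul_apply_eq_comp, ← map_mul,
        compactRankOne_mul_compactRankOne, map_smul, smul_apply, hev,
        inner_smul_right, inner_self_eq_norm_sq_to_K, hv]
      simp
  have hu₀ (z) : u₀ z = σ (compactRankOne z e) v := rfl
  have hint (T : compactOperators H) (z : H) : σ T (u₀ z) = u₀ (T.1 z) := by
    rw [hu₀, ← mul_apply_eq_comp, ← map_mul, mul_compactRankOne, hu₀]
  have hrange : LinearMap.range u₀.toLinearMap = ⊤ := by
    refine (hirr _ ?_ ?_).resolve_left fun h ↦ ?_
    · exact u₀.isometry.isClosedEmbedding.isClosed_range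
    · rintro T _ ⟨z, rfl⟩
      exact ⟨T.1 z, (hint T z).symm⟩
    · have : u₀ e ∈ LinearMap.range u₀.toLinearMap := ⟨e, rfl⟩
      rw [h, Submodule.mem_bot, hu₀, hev] at this
      simp [this] at hv
  let u := LinearIsometryEquiv.ofSurjective u₀ (LinearMap.range_eq_top.1 hrange)
  refine ⟨u, fun T ξ ↦ ?_⟩
  obtain ⟨z, rfl⟩ := u.surjective ξ
  rw [u.symm_apply_apply]
  exact hint T z

end CompactOperators

section ZeroAtInfty

variable {X E : Type*} [TopologicalSpace X] [NormedAddCommGroup E]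

namespace ZeroAtInftyContinuousMap

theorem norm_le_of_forall {k : C₀(X, E)} {C : ℝ} (hC : 0 ≤ C) (h : ∀ x, ‖k x‖ ≤ C) : ‖k‖ ≤ C :=
  (BoundedContinuousFunction.norm_le (f := k.toBCF) hC).2 h

theorem isCompact_setOf_le_norm (k : C₀(X, E)) {ε : ℝ} (hε : 0 < ε) :
    IsCompact {x | ε ≤ ‖k x‖} := by
  have h := (tendsto_zero_iff_norm_tendsto_zero.1 (zero_at_infty k)).eventually (gt_mem_nhds hε)
  obtain ⟨t, ht, htk⟩ := Filter.mem_cocompact.1 h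
  refine ht.of_isClosed_subset (isClosed_le continuous_const (by fun_prop)) fun x hx ↦ ?_
  by_contra hxt
  exact not_lt_of_ge (Set.mem_ofPred.1 hx) (htk hxt)

variable [NormedSpace ℂ E]

/-- The product of a function vanishing at infinity with a continuous function with values in
`[0, 1]`. -/
noncomputable def cutoff (k : C₀(X, E)) (g : C(X, ℝ)) (hg : ∀ x, g x ∈ Set.Icc (0 : ℝ) 1) :
    C₀(X, E) where
  toFun x := (g x : ℂ) • k x
  continuous_toFun := by fun_prop
  zero_at_infty' := by
    refine squeeze_zero_norm (fun x ↦ ?_) (tendsto_zero_iff_norm_tendsto_zero.1 (zero_at_infty k))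
    rw [norm_smul, Complex.norm_real, Real.norm_of_nonneg (hg x).1]
    exact mul_le_of_le_one_left (norm_nonneg _) (hg x).2

/-- The function `x ↦ f x • T` for a compactly supported real function `f`. -/
noncomputable def smulConst (f : C(X, ℝ)) (hf : HasCompactSupport f) (T : E) : C₀(X, E) where
  toFun x := (f x : ℂ) • T
  continuous_toFun := by fun_prop
  zero_at_infty' := by
    refine HasCompactSupport.is_zero_at_infty (hf.mono fun x hx h ↦ hx ?_)
    simp [h]

/-- Truncation: a function vanishing at infinity is uniformly close to its product with a cutoff
function supported where the original function is not small. -/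
theorem exists_cutoff (k : C₀(X, E)) {ε : ℝ} (hε : 0 < ε) :
    ∃ (g : C(X, ℝ)) (hg : ∀ x, g x ∈ Set.Icc (0 : ℝ) 1),
      (∀ x, ‖k x‖ < ε → g x = 0) ∧ ‖k - k.cutoff g hg‖ ≤ 2 * ε := by
  let g : C(X, ℝ) := ⟨fun x ↦ min 1 (max 0 (‖k x‖ / ε - 1)), by fun_prop⟩
  have hg_apply (x) : g x = min 1 (max 0 (‖k x‖ / ε - 1)) := rfl
  have hg (x) : g x ∈ Set.Icc (0 : ℝ) 1 := ⟨by simp [hg_apply], by simp [hg_apply]⟩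
  refine ⟨g, hg, fun x hx ↦ ?_, norm_le_of_forall (by positivity) fun x ↦ ?_⟩
  · have : ‖k x‖ / ε < 1 := (div_lt_one hε).2 hx
    rw [hg_apply, max_eq_left (by linarith), min_eq_right zero_le_one]
  · have h1 : (k - k.cutoff g hg) x = ((1 - g x : ℝ) : ℂ) • k x := by
      simp [cutoff, sub_smul]
    rw [h1, norm_smul, Complex.norm_real, Real.norm_of_nonneg (sub_nonneg.2 (hg x).2)]
    rcases le_total ‖k x‖ (2 * ε) with h | h
    · exact (mul_le_of_le_one_left (norm_nonneg _) (by linarith [(hg x).1])).trans h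
    · have : 2 ≤ ‖k x‖ / ε := (le_div_iff₀ hε).2 h
      have : g x = 1 := by
        rw [hg_apply, min_eq_left]
        exact le_max_of_le_right (by linarith)
      simp [this, hε.le]

end ZeroAtInftyContinuousMap

end ZeroAtInfty

section CompactValued

variable (X H : Type*) {H' : Type*} [TopologicalSpace X]
  [NormedAddCommGroup H] [InnerProductSpace ℂ H] [CompleteSpace H]
  [NormedAddCommGroup H'] [InnerProductSpace ℂ H'] [CompleteSpace H']

/-- The C⋆-algebra of functions vanishing at infinity with values in the compact operators. -/
def compactValued : NonUnitalStarSubalgebra ℂ C₀(X, H →L[ℂ] H) where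
  carrier := {k | ∀ x, k x ∈ compactOperators H}
  add_mem' hk hl x := add_mem (hk x) (hl x)
  zero_mem' _ := zero_mem (compactOperators H)
  mul_mem' hk hl x := mul_mem (hk x) (hl x)
  smul_mem' c _ hk x := SMulMemClass.smul_mem c (hk x)
  star_mem' hk x := star_mem (hk x)

instance isClosed_compactValued : IsClosed (compactValued X H : Set C₀(X, H →L[ℂ] H)) := by
  have h : (compactValued X H : Set C₀(X, H →L[ℂ] H)) =
      ⋂ x, (fun k ↦ k.toBCF x) ⁻¹' (compactOperators H : Set (H →L[ℂ] H)) := by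
    ext k
    rw [Set.mem_iInter]
    rfl
  rw [h]
  exact isClosed_iInter fun x ↦ isClosed_compactOperators.preimage
    ((BoundedContinuousFunction.lipschitz_eval_const x).continuous.comp
      ZeroAtInftyContinuousMap.isometry_toBCF.continuous)

variable {X H}

namespace compactValued

open ZeroAtInftyContinuousMap (exists_cutoff norm_le_of_forall isCompact_setOf_le_norm)

/-- The product of an element of `compactValued X H` with a continuous function with values in
`[0, 1]`. -/
noncomputable def cutoff (k : compactValued X H) (g : C(X, ℝ))
    (hg : ∀ x, g x ∈ Set.Icc (0 : ℝ) 1) : compactValued X H :=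
  ⟨k.1.cutoff g hg, fun x ↦ SMulMemClass.smul_mem (g x : ℂ) (k.2 x)⟩

theorem cutoff_apply (k : compactValued X H) (g : C(X, ℝ)) (hg : ∀ x, g x ∈ Set.Icc (0 : ℝ) 1)
    (x : X) : (cutoff k g hg).1 x = (g x : ℂ) • k.1 x := rfl

/-- The elementary tensor `x ↦ f x • T`. -/
noncomputable def tensor (f : C(X, ℝ)) (hf : HasCompactSupport f) (T : compactOperators H) :
    compactValued X H :=
  ⟨.smulConst f hf T, fun x ↦ SMulMemClass.smul_mem (f x : ℂ) T.2⟩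

theorem tensor_apply (f : C(X, ℝ)) (hf : HasCompactSupport f) (T : compactOperators H) (x : X) :
    (tensor f hf T).1 x = (f x : ℂ) • T.1 := rfl

theorem ext_apply {k l : compactValued X H} (h : ∀ x, k.1 x = l.1 x) : k = l :=
  Subtype.ext (ZeroAtInftyContinuousMap.ext h)

theorem coe_mul_apply (k l : compactValued X H) (x : X) : (k * l).1 x = k.1 x * l.1 x := rfl

/-- If a representation kills all cutoffs of `k` that vanish where `k` is small, then it
kills `k`. -/
theorem hom_eq_zero_of_cutoff (Φ : compactValued X H →⋆ₙₐ[ℂ] (H' →L[ℂ] H'))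
    (k : compactValued X H)
    (h : ∀ ε > 0, ∀ (g : C(X, ℝ)) (hg : ∀ x, g x ∈ Set.Icc (0 : ℝ) 1),
      (∀ x, ‖k.1 x‖ < ε → g x = 0) → Φ (cutoff k g hg) = 0) : Φ k = 0 := by
  refine norm_le_zero_iff.1 (le_of_forall_pos_le_add fun ε hε ↦ ?_)
  obtain ⟨g, hg, hgk, hle⟩ := exists_cutoff k.1 (half_pos hε)
  calc ‖Φ k‖ = ‖Φ (k - cutoff k g hg)‖ := by
        rw [map_sub Φ, h _ (half_pos hε) g hg hgk, sub_zero]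
    _ ≤ ‖k - cutoff k g hg‖ := NonUnitalStarAlgHom.norm_apply_le Φ _
    _ ≤ 2 * (ε / 2) := hle
    _ = 0 + ε := by ring

/-- A nonzero representation has a point in its support. -/
theorem exists_mem_support [LocallyCompactSpace X] [T2Space X]
    (Φ : compactValued X H →⋆ₙₐ[ℂ] (H' →L[ℂ] H')) (hΦ : ∃ k, Φ k ≠ 0) :
    ∃ x, ∀ U, IsOpen U → x ∈ U → ∃ k : compactValued X H, (∀ y ∉ U, k.1 y = 0) ∧ Φ k ≠ 0 := by
  by_contra! h
  choose U hU hxU hkU using h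
  obtain ⟨k, hk⟩ := hΦ
  refine hk (hom_eq_zero_of_cutoff Φ k fun ε hε g hg hgk ↦ ?_)
  have hK := isCompact_setOf_le_norm k.1 hε
  obtain ⟨t, ht⟩ := hK.elim_finite_subcover U hU fun x _ ↦ Set.mem_iUnion.2 ⟨x, hxU x⟩
  obtain ⟨ρ, hρ, -⟩ := PartitionOfUnity.exists_isSubordinate_of_locallyFinite_t2space hK
    (fun i : t ↦ U i) (fun i ↦ hU i) (locallyFinite_of_finite _)
    (by rwa [Set.iUnion_subtype (· ∈ t) fun i ↦ U i])
  have hρ01 (i : t) (x : X) : ρ i x ∈ Set.Icc (0 : ℝ) 1 := ⟨ρ.nonneg i x, ρ.le_one i x⟩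
  have hsum : cutoff k g hg = ∑ i, cutoff (cutoff k g hg) (ρ i) (hρ01 i) := by
    refine ext_apply fun x ↦ ?_
    have h1 : (∑ i, cutoff (cutoff k g hg) (ρ i) (hρ01 i)).1 x =
        ∑ i, (ρ i x : ℂ) • (cutoff k g hg).1 x :=
      map_sum (⟨⟨fun k ↦ k.1 x, rfl⟩, fun _ _ ↦ rfl⟩ : compactValued X H →+ (H →L[ℂ] H)) _ _
    rw [h1, ← Finset.sum_smul]
    by_cases hx : ε ≤ ‖k.1 x‖
    · have h2 : ∑ i, ρ i x = 1 := by
        rw [← finsum_eq_sum_of_fintype]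
        exact ρ.sum_eq_one hx
      rw [← Complex.ofReal_sum, h2, Complex.ofReal_one, one_smul]
    · simp [cutoff_apply, hgk x (not_le.1 hx)]
  rw [hsum, map_sum]
  refine Finset.sum_eq_zero fun i _ ↦ hkU i _ fun y hy ↦ ?_
  have : ρ i y = 0 := image_eq_zero_of_notMem_tsupport fun hy' ↦ hy (hρ i hy')
  rw [cutoff_apply, this, Complex.ofReal_zero, zero_smul]

/-- An irreducible representation factors through evaluation at any point of its support. -/
theorem hom_eq_zero_of_apply_eq_zero (Φ : compactValued X H →⋆ₙₐ[ℂ] (H' →L[ℂ] H'))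
    (hirr : ∀ V : Submodule ℂ H', IsClosed (V : Set H') → (∀ k, ∀ v ∈ V, Φ k v ∈ V) →
      V = ⊥ ∨ V = ⊤) {x : X}
    (hx : ∀ U, IsOpen U → x ∈ U → ∃ k : compactValued X H, (∀ y ∉ U, k.1 y = 0) ∧ Φ k ≠ 0)
    {k : compactValued X H} (hk : k.1 x = 0) : Φ k = 0 := by
  refine hom_eq_zero_of_cutoff Φ k fun ε hε g hg hgk ↦ ?_
  set U : Set X := {y | ‖k.1 y‖ < ε}
  obtain ⟨l, hlU, hl⟩ := hx U (isOpen_lt (by fun_prop) continuous_const) (by simpa [U, hk])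
  let V : Submodule ℂ H' :=
    ⨅ (m : compactValued X H) (_ : ∀ y ∈ U, m.1 y = 0), LinearMap.ker (Φ m).toLinearMap
  have hV (v : H') : v ∈ V ↔ ∀ m : compactValued X H, (∀ y ∈ U, m.1 y = 0) → Φ m v = 0 := by
    simp [V]
  have hVtop : V = ⊤ := by
    refine (hirr V ?_ fun a v hv ↦ ?_).resolve_left fun hbot ↦ hl ?_
    · simp only [V, Submodule.coe_iInf]
      exact isClosed_iInter fun m ↦ isClosed_iInter fun _ ↦ (Φ m).isClosed_ker
    · rw [hV] at hv ⊢
      intro m hm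
      rw [← mul_apply_eq_comp, ← map_mul]
      exact hv _ fun y hy ↦ by rw [coe_mul_apply, hm y hy, zero_mul]
    · refine ContinuousLinearMap.ext fun v ↦ ?_
      have hmem : Φ l v ∈ V := by
        rw [hV]
        intro m hm
        have : m * l = 0 := ext_apply fun y ↦ by
          rw [coe_mul_apply]
          by_cases hy : y ∈ U
          · rw [hm y hy, zero_mul]; rfl
          · rw [hlU y hy, mul_zero]; rfl
        rw [← mul_apply_eq_comp, ← map_mul, this, map_zero, zero_apply]
      rw [hbot] at hmem
      exact (Submodule.mem_bot ℂ).1 hmem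
  refine ContinuousLinearMap.ext fun v ↦ (hV v).1 (hVtop ▸ Submodule.mem_top) _ fun y hy ↦ ?_
  rw [cutoff_apply, hgk y hy, Complex.ofReal_zero, zero_smul]

/-- A representation that factors through evaluation at `x` comes from a representation of the
compact operators. -/
theorem exists_hom_of_factors [LocallyCompactSpace X] [T2Space X]
    (Φ : compactValued X H →⋆ₙₐ[ℂ] (H' →L[ℂ] H')) {x : X}
    (hx : ∀ k : compactValued X H, k.1 x = 0 → Φ k = 0) :
    ∃ σ : compactOperators H →⋆ₙₐ[ℂ] (H' →L[ℂ] H'), ∀ k, Φ k = σ ⟨k.1 x, k.2 x⟩ := by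
  obtain ⟨f, hf1, -, hf, -⟩ := exists_continuous_one_zero_of_isCompact
    (isCompact_singleton (x := x)) isClosed_empty (Set.disjoint_empty _)
  have hfx : f x = 1 := hf1 rfl
  have hcongr {k l : compactValued X H} (h : k.1 x = l.1 x) : Φ k = Φ l := by
    rw [← sub_eq_zero, ← map_sub]
    exact hx _ (sub_eq_zero.2 h)
  have ht (T : compactOperators H) : (tensor f hf T).1 x = T.1 := by simp [tensor_apply, hfx]
  refine ⟨
    { toFun := fun T ↦ Φ (tensor f hf T)
      map_smul' := fun c T ↦ ?_
      map_zero' := hx _ (ht 0)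
      map_add' := fun S T ↦ ?_
      map_mul' := fun S T ↦ ?_
      map_star' := fun T ↦ ?_ }, fun k ↦ hcongr (ht ⟨k.1 x, k.2 x⟩).symm⟩
  · exact (hcongr ((ht _).trans (congrArg (c • ·) (ht T)).symm)).trans
      (Φ.map_smul' c (tensor f hf T))
  · rw [← map_add]
    exact hcongr ((ht _).trans (congrArg₂ (· + ·) (ht S) (ht T)).symm)
  · rw [← map_mul]
    exact hcongr ((ht _).trans (congrArg₂ (· * ·) (ht S) (ht T)).symm)
  · rw [← map_star]
    exact hcongr ((ht _).trans (congrArg star (ht T)).symm)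

/-- Evaluations at distinct points are distinguished by their kernels. -/
theorem exists_apply_ne_zero_apply_eq_zero [LocallyCompactSpace X] [T2Space X] [Nontrivial H]
    {x y : X} (hxy : x ≠ y) : ∃ k : compactValued X H, k.1 x ≠ 0 ∧ k.1 y = 0 := by
  obtain ⟨f, hf1, hf0, hf, -⟩ := exists_continuous_one_zero_of_isCompact
    (isCompact_singleton (x := x)) (isClosed_singleton (x := y)) (by simpa using hxy)
  obtain ⟨e, he⟩ := exists_ne (0 : H)
  refine ⟨tensor f hf (compactRankOne e e), ?_, ?_⟩
  · rw [tensor_apply, hf1 rfl]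
    simpa [compactRankOne] using he
  · rw [tensor_apply, hf0 rfl]
    simp

end compactValued

end CompactValued



/-- Every irreducible representation of `C₀(X, K(H))` (for `X` locally compact Hausdorff and
`H` a nonzero complex Hilbert space) is unitarily equivalent to the evaluation representation
`ev_x : k ↦ k(x)` at a unique point `x ∈ X`. -/
theorem irreducible_rep_of_C0XKH_is_evaluation
    {X : Type} [TopologicalSpace X] [LocallyCompactSpace X] [T2Space X]
    {H : Type} [NormedAddCommGroup H] [InnerProductSpace ℂ H] [CompleteSpace H] [Nontrivial H]
    {H' : Type} [NormedAddCommGroup H'] [InnerProductSpace ℂ H'] [CompleteSpace H'] [Nontrivial H']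
    (π : C₀(X, H →L[ℂ] H) → (H' →L[ℂ] H'))
    (h_add : ∀ k l : C₀(X, H →L[ℂ] H), (∀ x : X, IsCompactOperator (k x)) →
      (∀ x : X, IsCompactOperator (l x)) → π (k + l) = π k + π l)
    (h_smul : ∀ (c : ℂ) (k : C₀(X, H →L[ℂ] H)), (∀ x : X, IsCompactOperator (k x)) →
      π (c • k) = c • π k)
    (h_mul : ∀ k l : C₀(X, H →L[ℂ] H), (∀ x : X, IsCompactOperator (k x)) →
      (∀ x : X, IsCompactOperator (l x)) → π (k * l) = π k * π l)
    (h_star : ∀ k : C₀(X, H →L[ℂ] H), (∀ x : X, IsCompactOperator (k x)) →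
      π (star k) = star (π k))
    (h_nonzero : ∃ k : C₀(X, H →L[ℂ] H), (∀ x : X, IsCompactOperator (k x)) ∧ π k ≠ 0)
    (h_irr : ∀ V : Submodule ℂ H', IsClosed (V : Set H') →
      (∀ k : C₀(X, H →L[ℂ] H), (∀ x : X, IsCompactOperator (k x)) →
        ∀ v ∈ V, π k v ∈ V) → V = ⊥ ∨ V = ⊤) :
    ∃! x : X, ∃ u : H ≃ₗᵢ[ℂ] H',
      ∀ k : C₀(X, H →L[ℂ] H), (∀ y : X, IsCompactOperator (k y)) →
        ∀ ξ : H', π k ξ = u ((k x) (u.symm ξ)) := by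
  let Φ : compactValued X H →⋆ₙₐ[ℂ] (H' →L[ℂ] H') :=
    { toFun := fun k ↦ π k.1
      map_smul' := fun c k ↦ h_smul c k.1 k.2
      map_zero' := by simpa using h_smul 0 0 (zero_mem (compactValued X H))
      map_add' := fun k l ↦ h_add k.1 l.1 k.2 l.2
      map_mul' := fun k l ↦ h_mul k.1 l.1 k.2 l.2
      map_star' := fun k ↦ h_star k.1 k.2 }
  have hΦ : ∃ k, Φ k ≠ 0 := h_nonzero.elim fun k hk ↦ ⟨⟨k, hk.1⟩, hk.2⟩
  have hirr (V : Submodule ℂ H') (hV : IsClosed (V : Set H')) (h : ∀ k, ∀ v ∈ V, Φ k v ∈ V) :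
      V = ⊥ ∨ V = ⊤ :=
    h_irr V hV fun k hk ↦ h ⟨k, hk⟩
  obtain ⟨x, hx⟩ := compactValued.exists_mem_support Φ hΦ
  obtain ⟨σ, hσ⟩ := compactValued.exists_hom_of_factors Φ
    fun k ↦ compactValued.hom_eq_zero_of_apply_eq_zero Φ hirr hx
  obtain ⟨u, hu⟩ := compactOperators.exists_linearIsometryEquiv_of_irreducible σ
    (hΦ.elim fun k hk ↦ ⟨_, hσ k ▸ hk⟩)
    fun V hV h ↦ hirr V hV fun k v hv ↦ by simpa only [hσ k] using h _ v hv
  have hux (k : C₀(X, H →L[ℂ] H)) (hk : ∀ y, IsCompactOperator (k y)) (ξ : H') :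
      π k ξ = u (k x (u.symm ξ)) :=
    (DFunLike.congr_fun (hσ ⟨k, hk⟩) ξ).trans (hu _ ξ)
  refine ⟨x, ⟨u, hux⟩, fun y ⟨w, hw⟩ ↦ ?_⟩
  by_contra hyx
  obtain ⟨k, hkx, hky⟩ := compactValued.exists_apply_ne_zero_apply_eq_zero (H := H) (Ne.symm hyx)
  refine hkx (ContinuousLinearMap.ext fun z ↦ u.injective ?_)
  have h := (hux k.1 k.2 (u z)).symm.trans (hw k.1 k.2 (u z))
  rw [u.symm_apply_apply, hky, zero_apply, map_zero] at h
  rw [h, zero_apply, map_zero]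
end
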